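/- Let 𝒟 be a family of relativizable generalized dependencies. Then 𝒟 is doubly strongly first order if and only if every D ∈ 𝒟 is doubly strongly first order. -/

import Mathlib

namespace DSFO

/-- A purely relational signature: for each arity, a type of relation symbols. -/
abbrev Signature := ℕ → Type

/-- The empty signature. -/
def Sig0 : Signature := fun _ => Empty

/-- The signature with a single `k`-ary relation symbol `R`. -/
def SigR (k : ℕ) : Signature := fun n => PLift (n = k)

/-- Syntax of team-semantics formulas (in negation normal form, with the two
additional connectives: global disjunction `gdisj` and contradictory negation
`cneg`) over a relational signature `S`, with generalized dependency atoms
indexed by `ι` with arities `ar`.  Variables are natural numbers. -/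
inductive TS (S : Signature) (ι : Type) (ar : ι → ℕ) : Type
  | rel {k : ℕ} (r : S k) (v : Fin k → ℕ)
  | nrel {k : ℕ} (r : S k) (v : Fin k → ℕ)
  | eq (x y : ℕ)
  | neq (x y : ℕ)
  | dep (i : ι) (v : Fin (ar i) → ℕ)
  | and (φ ψ : TS S ι ar)
  | or (φ ψ : TS S ι ar)
  | gdisj (φ ψ : TS S ι ar)
  | cneg (φ : TS S ι ar)
  | ex (v : ℕ) (φ : TS S ι ar)
  | al (v : ℕ) (φ : TS S ι ar)

/-- The always-true literal `⊤`. -/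
def TS.top {S : Signature} {ι : Type} {ar : ι → ℕ} : TS S ι ar := .eq 0 0

/-- The arity function for "no dependency atoms". -/
def noAtoms : Empty → ℕ := fun e => e.elim

/-- First-order formulas over `S` (no dependency atoms; here `cneg` plays the
role of ordinary classical negation and `gdisj` of ordinary disjunction, so
this is full first-order logic). -/
abbrev FOF (S : Signature) := TS S Empty noAtoms

/-- First-order formulas over the empty signature. -/
abbrev EF := FOF Sig0

/-- Free variables of a formula. -/
def fv {S : Signature} {ι : Type} {ar : ι → ℕ} : TS S ι ar → Set ℕ
  | .rel _ v => Set.range v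
  | .nrel _ v => Set.range v
  | .eq x y => {x, y}
  | .neq x y => {x, y}
  | .dep _ v => Set.range v
  | .and φ ψ => fv φ ∪ fv ψ
  | .or φ ψ => fv φ ∪ fv ψ
  | .gdisj φ ψ => fv φ ∪ fv ψ
  | .cneg φ => fv φ
  | .ex v φ => fv φ \ {v}
  | .al v φ => fv φ \ {v}

/-- A sentence is a formula with no free variables. -/
def IsSentence {S : Signature} {ι : Type} {ar : ι → ℕ} (φ : TS S ι ar) : Prop :=
  fv φ = ∅

/-- No global disjunctions occur. -/
def NoGdisj {S : Signature} {ι : Type} {ar : ι → ℕ} : TS S ι ar → Prop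
  | .rel _ _ => True
  | .nrel _ _ => True
  | .eq _ _ => True
  | .neq _ _ => True
  | .dep _ _ => True
  | .and φ ψ => NoGdisj φ ∧ NoGdisj ψ
  | .or φ ψ => NoGdisj φ ∧ NoGdisj ψ
  | .gdisj _ _ => False
  | .cneg φ => NoGdisj φ
  | .ex _ φ => NoGdisj φ
  | .al _ φ => NoGdisj φ

/-- No contradictory negations occur. -/
def NoCneg {S : Signature} {ι : Type} {ar : ι → ℕ} : TS S ι ar → Prop
  | .rel _ _ => True
  | .nrel _ _ => True
  | .eq _ _ => True
  | .neq _ _ => True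
  | .dep _ _ => True
  | .and φ ψ => NoCneg φ ∧ NoCneg ψ
  | .or φ ψ => NoCneg φ ∧ NoCneg ψ
  | .gdisj φ ψ => NoCneg φ ∧ NoCneg ψ
  | .cneg _ => False
  | .ex _ φ => NoCneg φ
  | .al _ φ => NoCneg φ

/-- Formulas of `FO(𝒟)` proper: no `gdisj` and no `cneg`. -/
def Plain {S : Signature} {ι : Type} {ar : ι → ℕ} (φ : TS S ι ar) : Prop :=
  NoCneg φ ∧ NoGdisj φ

/-- Atomic formulas: first-order literals and dependency atoms. -/
def Atomic {S : Signature} {ι : Type} {ar : ι → ℕ} : TS S ι ar → Prop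
  | .rel _ _ => True
  | .nrel _ _ => True
  | .eq _ _ => True
  | .neq _ _ => True
  | .dep _ _ => True
  | _ => False

/-- Formulas of `FO(∼₀, 𝒟)`: the contradictory negation may appear only in
front of first-order literals and dependency atoms (and there is no `gdisj`). -/
def Cneg0 {S : Signature} {ι : Type} {ar : ι → ℕ} : TS S ι ar → Prop
  | .rel _ _ => True
  | .nrel _ _ => True
  | .eq _ _ => True
  | .neq _ _ => True
  | .dep _ _ => True
  | .and φ ψ => Cneg0 φ ∧ Cneg0 ψ
  | .or φ ψ => Cneg0 φ ∧ Cneg0 ψ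
  | .gdisj _ _ => False
  | .cneg φ => Atomic φ
  | .ex _ φ => Cneg0 φ
  | .al _ φ => Cneg0 φ

/-- The negation normal form of the (dual) negation of a formula. -/
def TS.nneg {S : Signature} {ι : Type} {ar : ι → ℕ} : TS S ι ar → TS S ι ar
  | .rel r v => .nrel r v
  | .nrel r v => .rel r v
  | .eq x y => .neq x y
  | .neq x y => .eq x y
  | .dep i v => .cneg (.dep i v)
  | .and φ ψ => .or (TS.nneg φ) (TS.nneg ψ)
  | .or φ ψ => .and (TS.nneg φ) (TS.nneg ψ)
  | .gdisj φ ψ => .and (TS.nneg φ) (TS.nneg ψ)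
  | .cneg φ => φ
  | .ex v φ => .al v (TS.nneg φ)
  | .al v φ => .ex v (TS.nneg φ)

/-- Iterated existential quantification over a list of variables. -/
def exs {S : Signature} {ι : Type} {ar : ι → ℕ} (l : List ℕ) (φ : TS S ι ar) :
    TS S ι ar := l.foldr TS.ex φ

/-- An interpretation of a relational signature in a domain `M`. -/
abbrev Interp (S : Signature) (M : Type) := ∀ k, S k → Set (Fin k → M)

/-- The unique interpretation of the empty signature. -/
def eI (M : Type) : Interp Sig0 M := fun _ e => e.elim

/-- The interpretation of `SigR k` given by a `k`-ary relation `R`. -/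
def interpR {k : ℕ} {M : Type} (R : Set (Fin k → M)) : Interp (SigR k) M :=
  fun _ r => {s | (fun i => s (Fin.cast r.down.symm i)) ∈ R}

/-- Tarskian (single-assignment) satisfaction.  Dependency atoms are
(vacuously) interpreted as true; this is only used on first-order formulas. -/
def FSat {S : Signature} {ι : Type} {ar : ι → ℕ} (M : Type) (I : Interp S M) :
    (ℕ → M) → TS S ι ar → Prop
  | s, .rel r v => (fun i => s (v i)) ∈ I _ r
  | s, .nrel r v => (fun i => s (v i)) ∉ I _ r
  | s, .eq x y => s x = s y
  | s, .neq x y => s x ≠ s y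
  | _, .dep _ _ => True
  | s, .and φ ψ => FSat M I s φ ∧ FSat M I s ψ
  | s, .or φ ψ => FSat M I s φ ∨ FSat M I s ψ
  | s, .gdisj φ ψ => FSat M I s φ ∨ FSat M I s ψ
  | s, .cneg φ => ¬ FSat M I s φ
  | s, .ex v φ => ∃ m : M, FSat M I (Function.update s v m) φ
  | s, .al v φ => ∀ m : M, FSat M I (Function.update s v m) φ

/-- Truth of a first-order sentence (Tarskian semantics). -/
def FOTrue {S : Signature} {ι : Type} {ar : ι → ℕ} (M : Type) (I : Interp S M)
    (φ : TS S ι ar) : Prop :=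
  ∀ s : ℕ → M, FSat M I s φ

/-- The relation `X(x̄)` determined by a team `X` and a tuple of variables `x̄`. -/
def teamProj {M : Type} {k : ℕ} (v : Fin k → ℕ) (X : Set (ℕ → M)) :
    Set (Fin k → M) := {t | ∃ s ∈ X, t = fun j => s (v j)}

/-- (Lax) team semantics.  `A` gives the semantics of each dependency atom as a
function of the relation `X(x̄)`. -/
def TSat {S : Signature} {ι : Type} {ar : ι → ℕ} (M : Type) (I : Interp S M)
    (A : ∀ i, Set (Fin (ar i) → M) → Prop) :
    TS S ι ar → Set (ℕ → M) → Prop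
  | .rel r v, X => ∀ s ∈ X, (fun i => s (v i)) ∈ I _ r
  | .nrel r v, X => ∀ s ∈ X, (fun i => s (v i)) ∉ I _ r
  | .eq x y, X => ∀ s ∈ X, s x = s y
  | .neq x y, X => ∀ s ∈ X, s x ≠ s y
  | .dep i v, X => A i (teamProj v X)
  | .and φ ψ, X => TSat M I A φ X ∧ TSat M I A ψ X
  | .or φ ψ, X => ∃ Y Z : Set (ℕ → M), Y ∪ Z = X ∧ TSat M I A φ Y ∧ TSat M I A ψ Z
  | .gdisj φ ψ, X => TSat M I A φ X ∨ TSat M I A ψ X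
  | .cneg φ, X => ¬ TSat M I A φ X
  | .ex v φ, X => ∃ H : (ℕ → M) → Set M, (∀ s ∈ X, (H s).Nonempty) ∧
      TSat M I A φ {s' | ∃ s ∈ X, ∃ m ∈ H s, s' = Function.update s v m}
  | .al v φ, X => TSat M I A φ {s' | ∃ s ∈ X, ∃ m : M, s' = Function.update s v m}

/-- Truth of a sentence under team semantics: satisfaction by the team of all
assignments (by locality, equivalent to satisfaction by `{∅}`). -/
def TTrue {S : Signature} {ι : Type} {ar : ι → ℕ} (M : Type) (I : Interp S M)
    (A : ∀ i, Set (Fin (ar i) → M) → Prop) (φ : TS S ι ar) : Prop :=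
  TSat M I A φ Set.univ

/-- A `k`-ary dependency predicate: a class of pairs `(M, R)`. -/
abbrev DepPred (k : ℕ) := ∀ M : Type, Set (Fin k → M) → Prop

/-- Closure under isomorphisms (part of the definition of a generalized
dependency). -/
def IsoClosed {k : ℕ} (D : DepPred k) : Prop :=
  ∀ (M N : Type) (e : M ≃ N) (R : Set (Fin k → M)),
    D M R → D N ((fun f => e ∘ f) '' R)

/-- The complement `∼D` of a dependency. -/
def complD {k : ℕ} (D : DepPred k) : DepPred k := fun M R => ¬ D M R

def DownwardsClosed {k : ℕ} (D : DepPred k) : Prop :=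
  ∀ (M : Type) (R R' : Set (Fin k → M)), D M R → R' ⊆ R → D M R'

/-- The downwards closure `D↓`. -/
def dClosure {k : ℕ} (D : DepPred k) : DepPred k :=
  fun M R => ∃ R', R ⊆ R' ∧ D M R'

/-- `D_max`: the maximal models of `D`. -/
def DMax {k : ℕ} (D : DepPred k) : DepPred k :=
  fun M R => D M R ∧ ∀ R', R ⊂ R' → ¬ D M R'

/-- The empty team property. -/
def EmptyTeamProp {k : ℕ} (D : DepPred k) : Prop :=
  ∀ M : Type, Nontrivial M → D M (∅ : Set (Fin k → M))

/-- `D` is a first-order dependency: it is the class of models of a first-order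
sentence over the signature `{R}`. -/
def FirstOrderDep {k : ℕ} (D : DepPred k) : Prop :=
  ∃ ψ : FOF (SigR k), IsSentence ψ ∧
    ∀ (M : Type), Nontrivial M → ∀ R : Set (Fin k → M),
      (D M R ↔ FOTrue M (interpR R) ψ)

/-- The interpretation of a unary predicate symbol as a subset of the domain. -/
def PSet {S : Signature} {M : Type} (I : Interp S M) (P : S 1) : Set M :=
  {m | (fun _ => m) ∈ I 1 P}

/-- Semantics of the relativization `D^(P)` of `D` to the unary predicate `P`:
`𝔐 ⊨_X D^(P) x̄` iff `(P^𝔐, X(x̄)) ∈ D`. -/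
def relSem {k : ℕ} (D : DepPred k) {S : Signature} (P : S 1)
    (M : Type) (I : Interp S M) (R : Set (Fin k → M)) : Prop :=
  (∀ f ∈ R, ∀ j, f j ∈ PSet I P) ∧
    D (↥(PSet I P)) {g : Fin k → ↥(PSet I P) | (fun j => (g j : M)) ∈ R}

/-- A family `𝒟` of generalized dependencies is strongly first order: every
sentence of `FO(𝒟)` is equivalent to some first-order sentence. -/
def SFOFam {ι : Type} {ar : ι → ℕ} (D : ∀ i, DepPred (ar i)) : Prop :=
  ∀ (S : Signature) (φ : TS S ι ar), IsSentence φ → Plain φ →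
    ∃ ψ : FOF S, IsSentence ψ ∧
      ∀ (M : Type), Nontrivial M → ∀ I : Interp S M,
        (TTrue M I (fun i => D i M) φ ↔ FOTrue M I ψ)

/-- A single dependency is strongly first order iff `{D}` is. -/
def SFOd {k : ℕ} (D : DepPred k) : Prop :=
  SFOFam (ι := Unit) (ar := fun _ => k) (fun _ => D)

/-- A family `𝒟` is relativizable: every sentence of `FO(𝒟^(P))` is equivalent
to some sentence of `FO(𝒟)`. -/
def RelativizableFam {ι : Type} {ar : ι → ℕ} (D : ∀ i, DepPred (ar i)) : Prop :=
  ∀ (S : Signature) (P : S 1) (φ : TS S ι ar), IsSentence φ → Plain φ →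
    ∃ ψ : TS S ι ar, IsSentence ψ ∧ Plain ψ ∧
      ∀ (M : Type), Nontrivial M → ∀ I : Interp S M,
        (TTrue M I (fun i => relSem (D i) P M I) φ ↔ TTrue M I (fun i => D i M) ψ)

def Relativizable1 {k : ℕ} (D : DepPred k) : Prop :=
  RelativizableFam (ι := Unit) (ar := fun _ => k) (fun _ => D)

/-- The family `𝒟 ∪ ∼𝒟`. -/
def withComplFam {ι : Type} {ar : ι → ℕ} (D : ∀ i, DepPred (ar i)) :
    ∀ i : ι ⊕ ι, DepPred (Sum.elim ar ar i) :=
  fun i => match i with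
    | .inl a => D a
    | .inr a => complD (D a)

/-- `D` is doubly strongly first order: `{D, ∼D}` is strongly first order. -/
def DSFOd {k : ℕ} (D : DepPred k) : Prop :=
  SFOFam (ι := Bool) (ar := fun _ => k)
    (fun b => match b with | true => D | false => complD D)

/-- The constancy atom of arity `k`. -/
def constD (k : ℕ) : DepPred k := fun _ R => ∀ f ∈ R, ∀ g ∈ R, f = g

/-- The totality atom of arity `k`. -/
def allD (k : ℕ) : DepPred k := fun M R => R = (Set.univ : Set (Fin k → M))

/-- The family `𝒟 ∪ {const}` (constancy atoms of every arity). -/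
def withConst {ι : Type} {ar : ι → ℕ} (D : ∀ i, DepPred (ar i)) :
    ∀ i : ι ⊕ ℕ, DepPred (Sum.elim ar id i) :=
  fun i => match i with
    | .inl a => D a
    | .inr n => constD n

/-- The atoms of `𝒟^(P) ∪ {const}`. -/
def withConstRel {ι : Type} {ar : ι → ℕ} (D : ∀ i, DepPred (ar i))
    {S : Signature} (P : S 1) (M : Type) (I : Interp S M) :
    ∀ i : ι ⊕ ℕ, Set (Fin (Sum.elim ar id i) → M) → Prop :=
  fun i => match i with
    | .inl a => relSem (D a) P M I
    | .inr n => constD n M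

/-- Atom indices of the logic `FO(𝒟₀, ⊔, const, All)`: the 0-ary first-order
dependencies `[ψ]`, the constancy atoms and the totality atoms. -/
inductive CIdx : Type
  | d0 (ψ : EF) (hψ : IsSentence ψ)
  | const (k : ℕ)
  | total (k : ℕ)

def cAr : CIdx → ℕ
  | .d0 _ _ => 0
  | .const k => k
  | .total k => k

def cSem (M : Type) : ∀ i : CIdx, Set (Fin (cAr i) → M) → Prop
  | .d0 ψ _, _ => FOTrue M (eI M) ψ
  | .const _, R => ∀ f ∈ R, ∀ g ∈ R, f = g
  | .total _, R => R = Set.univ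

/-- Embedding of first-order formulas over the empty signature into any
team logic. -/
def embedEF {S : Signature} {ι : Type} {ar : ι → ℕ} : EF → TS S ι ar
  | .rel r _ => Empty.elim r
  | .nrel r _ => Empty.elim r
  | .eq x y => .eq x y
  | .neq x y => .neq x y
  | .dep i _ => Empty.elim i
  | .and φ ψ => .and (embedEF φ) (embedEF ψ)
  | .or φ ψ => .or (embedEF φ) (embedEF ψ)
  | .gdisj φ ψ => .gdisj (embedEF φ) (embedEF ψ)
  | .cneg φ => .cneg (embedEF φ)
  | .ex v φ => .ex v (embedEF φ)
  | .al v φ => .al v (embedEF φ)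

/-- Override the values of the variables `0, …, k-1` by the tuple `f`. -/
def overrideFin {M : Type} (k : ℕ) (f : Fin k → M) (s : ℕ → M) : ℕ → M :=
  fun v => if h : v < k then f ⟨v, h⟩ else s v

/-- `(M, R) ⊨ ∃ȳ ∀x̄ (R x̄ → θ(x̄, ȳ))`, where `x̄` is the tuple of variables
`0, …, k-1` and the remaining free variables `ȳ` of `θ` are witnessed by `s`. -/
def ExAllSem {k : ℕ} (M : Type) (R : Set (Fin k → M)) (θ : EF) : Prop :=
  ∃ s : ℕ → M, ∀ f ∈ R, FSat M (eI M) (overrideFin k f s) θ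

/-- `(M, R) ⊨ ∃ȳ ∀x̄ (R x̄ ↔ θ(x̄, ȳ))`. -/
def ExAllIffSem {k : ℕ} (M : Type) (R : Set (Fin k → M)) (θ : EF) : Prop :=
  ∃ s : ℕ → M, ∀ f : Fin k → M, (f ∈ R ↔ FSat M (eI M) (overrideFin k f s) θ)

/-- The assignment sending `x̄ = (0, …, k-1)` to `f`, `ȳ = (k, …, k+n-1)` to
`a`, and every other variable to its value under `s0`. -/
def tupAsg {M : Type} (k n : ℕ) (f : Fin k → M) (a : Fin n → M) (s0 : ℕ → M) :
    ℕ → M :=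
  fun v => if h : v < k then f ⟨v, h⟩ else if h2 : v - k < n then a ⟨v - k, h2⟩ else s0 v

/-- `R` is defined by the formula `θ(x̄, ȳ)` (with `x̄ = (0, …, k-1)` and
`ȳ = (k, …, k+n-1)`): there is a tuple `ā` of parameters such that
`R = {m̄ : 𝔐 ⊨ θ(m̄, ā)}`. -/
def DefinedBy {S : Signature} {M : Type} (I : Interp S M) (k n : ℕ)
    (θ : FOF S) (R : Set (Fin k → M)) : Prop :=
  ∃ a : Fin n → M, ∀ s0 : ℕ → M, R = {f | FSat M I (tupAsg k n f a s0) θ}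

/-- `θ(x̄, ȳ)` fixes the identity type of `ȳ = (k, …, k+n-1)`. -/
def FixesIdType {S : Signature} (k n : ℕ) (θ : FOF S) : Prop :=
  ∀ i j : Fin n,
    (∀ (M : Type), Nontrivial M → ∀ (I : Interp S M) (s : ℕ → M),
        FSat M I s θ → s (k + (i : ℕ)) = s (k + (j : ℕ))) ∨
    (∀ (M : Type), Nontrivial M → ∀ (I : Interp S M) (s : ℕ → M),
        FSat M I s θ → s (k + (i : ℕ)) ≠ s (k + (j : ℕ)))

/-- `(M, R := Xv) ⊨ ∃ȳ ∀x̄ (R x̄ → θ(x̄, ȳ))` where the `x̄`-slots of `θ` are the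
variables `v̄` and the `ȳ`-slots are the variables `ȳ`. -/
def projExAll {M : Type} {k n : ℕ} (v : Fin k → ℕ) (y : Fin n → ℕ) (θ : EF)
    (Xv : Set (Fin k → M)) : Prop :=
  ∃ b : Fin n → M, ∀ f ∈ Xv, ∀ s : ℕ → M,
    (∀ j, s (v j) = f j) → (∀ i, s (y i) = b i) → FSat M (eI M) s θ

section Basics

variable {S : Signature} {ι : Type} {ar : ι → ℕ}

theorem plain_and {φ ψ : TS S ι ar} : Plain (.and φ ψ) ↔ Plain φ ∧ Plain ψ := by
  simp only [Plain, NoCneg, NoGdisj]; tauto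

theorem plain_or {φ ψ : TS S ι ar} : Plain (.or φ ψ) ↔ Plain φ ∧ Plain ψ := by
  simp only [Plain, NoCneg, NoGdisj]; tauto

theorem plain_ex {v : ℕ} {φ : TS S ι ar} : Plain (.ex v φ) ↔ Plain φ := Iff.rfl

theorem plain_al {v : ℕ} {φ : TS S ι ar} : Plain (.al v φ) ↔ Plain φ := Iff.rfl

/-- Iterated universal quantification over a list of variables. -/
def als (l : List ℕ) (φ : TS S ι ar) : TS S ι ar := l.foldr TS.al φ

theorem plain_als {l : List ℕ} {φ : TS S ι ar} : Plain (als l φ) ↔ Plain φ := by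
  induction l with
  | nil => rfl
  | cons v l ih => exact ih

theorem plain_exs {l : List ℕ} {φ : TS S ι ar} : Plain (exs l φ) ↔ Plain φ := by
  induction l with
  | nil => rfl
  | cons v l ih => exact ih

/-- The assignments `s` and `s'` agree outside the variables in `l`. -/
def AgreeOff {M : Type} (l : List ℕ) (s s' : ℕ → M) : Prop := ∀ x, x ∉ l → s' x = s x

theorem AgreeOff.refl {M : Type} {l : List ℕ} (s : ℕ → M) : AgreeOff l s s := fun _ _ => rfl

theorem AgreeOff.cons_iff {M : Type} {v : ℕ} {l : List ℕ} {s s' : ℕ → M} :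
    AgreeOff (v :: l) s s' ↔ ∃ m, AgreeOff l (Function.update s v m) s' := by
  constructor
  · intro h
    refine ⟨s' v, fun x hx => ?_⟩
    by_cases hv : x = v
    · subst hv; simp
    · rw [Function.update_of_ne hv]
      exact h x (by simp [hv, hx])
  · rintro ⟨m, h⟩ x hx
    simp only [List.mem_cons, not_or] at hx
    rw [h x hx.2, Function.update_of_ne hx.1]

theorem AgreeOff.nil_iff {M : Type} {s s' : ℕ → M} : AgreeOff [] s s' ↔ s' = s := by
  simp [AgreeOff, funext_iff]

theorem tsat_als {M : Type} {I : Interp S M} {A : ∀ i, Set (Fin (ar i) → M) → Prop}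
    (l : List ℕ) (φ : TS S ι ar) (X : Set (ℕ → M)) :
    TSat M I A (als l φ) X ↔ TSat M I A φ {s' | ∃ s ∈ X, AgreeOff l s s'} := by
  induction l generalizing X with
  | nil => simp [als, AgreeOff.nil_iff]
  | cons v l ih =>
    change TSat M I A (als l φ) _ ↔ _
    rw [ih]
    have : {s' | ∃ s ∈ {s' | ∃ s ∈ X, ∃ m : M, s' = Function.update s v m}, AgreeOff l s s'} =
        {s' | ∃ s ∈ X, AgreeOff (v :: l) s s'} := by
      ext s'
      simp only [Set.mem_ofPred_eq, AgreeOff.cons_iff]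
      constructor
      · rintro ⟨_, ⟨s, hs, m, rfl⟩, h⟩; exact ⟨s, hs, m, h⟩
      · rintro ⟨s, hs, m, h⟩; exact ⟨_, ⟨s, hs, m, rfl⟩, h⟩
    rw [this]

/-- `X'` extends the team `X` by (nonempty sets of) new values for the variables in `l`. -/
def Ext {M : Type} (l : List ℕ) (X X' : Set (ℕ → M)) : Prop :=
  (∀ s' ∈ X', ∃ s ∈ X, AgreeOff l s s') ∧ ∀ s ∈ X, ∃ s' ∈ X', AgreeOff l s s'

theorem tsat_exs {M : Type} {I : Interp S M} {A : ∀ i, Set (Fin (ar i) → M) → Prop}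
    (l : List ℕ) (φ : TS S ι ar) (X : Set (ℕ → M)) :
    TSat M I A (exs l φ) X ↔ ∃ X', Ext l X X' ∧ TSat M I A φ X' := by
  induction l generalizing X with
  | nil =>
    constructor
    · intro h
      exact ⟨X, ⟨fun s hs => ⟨s, hs, .refl s⟩, fun s hs => ⟨s, hs, .refl s⟩⟩, h⟩
    · rintro ⟨X', ⟨h1, h2⟩, h⟩
      have : X' = X := by
        ext s
        constructor
        · intro hs
          obtain ⟨t, ht, e⟩ := h1 s hs
          rwa [AgreeOff.nil_iff.1 e]
        · intro hs
          obtain ⟨t, ht, e⟩ := h2 s hs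
          rwa [← AgreeOff.nil_iff.1 e]
      rwa [this] at h
  | cons v l ih =>
    constructor
    · rintro ⟨H, hH, h⟩
      obtain ⟨X', ⟨h1, h2⟩, h⟩ := (ih _).1 h
      refine ⟨X', ⟨fun s' hs' => ?_, fun s hs => ?_⟩, h⟩
      · obtain ⟨_, ⟨s, hs, m, -, rfl⟩, e⟩ := h1 s' hs'
        exact ⟨s, hs, AgreeOff.cons_iff.2 ⟨m, e⟩⟩
      · obtain ⟨m, hm⟩ := hH s hs
        obtain ⟨s', hs', e⟩ := h2 _ ⟨s, hs, m, hm, rfl⟩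
        exact ⟨s', hs', AgreeOff.cons_iff.2 ⟨m, e⟩⟩
    · rintro ⟨X', ⟨h1, h2⟩, h⟩
      have key : ∀ s s' : ℕ → M, AgreeOff (v :: l) s s' →
          AgreeOff l (Function.update s v (s' v)) s' := by
        intro s s' e x hx
        by_cases hv : x = v
        · subst hv; simp
        · rw [Function.update_of_ne hv]
          exact e x (by simp [hv, hx])
      refine ⟨fun s => {m | ∃ s' ∈ X', AgreeOff (v :: l) s s' ∧ m = s' v}, ?_, ?_⟩
      · intro s hs
        obtain ⟨s', hs', e⟩ := h2 s hs
        exact ⟨s' v, s', hs', e, rfl⟩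
      · refine (ih _).2 ⟨X', ⟨fun s' hs' => ?_, ?_⟩, h⟩
        · obtain ⟨s, hs, e⟩ := h1 s' hs'
          exact ⟨_, ⟨s, hs, s' v, ⟨s', hs', e, rfl⟩, rfl⟩, key s s' e⟩
        · rintro _ ⟨s, hs, _, ⟨s', hs', e, rfl⟩, rfl⟩
          exact ⟨s', hs', key s s' e⟩

theorem Ext.nonempty {M : Type} {l : List ℕ} {X X' : Set (ℕ → M)} (h : Ext l X X')
    (hX : X.Nonempty) : X'.Nonempty := by
  obtain ⟨s, hs⟩ := hX
  obtain ⟨s', hs', -⟩ := h.2 s hs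
  exact ⟨s', hs'⟩

theorem fv_finite (φ : TS S ι ar) : (fv φ).Finite := by
  induction φ with
  | rel r v => exact Set.finite_range v
  | nrel r v => exact Set.finite_range v
  | eq x y => exact (Set.finite_singleton y).insert x
  | neq x y => exact (Set.finite_singleton y).insert x
  | dep i v => exact Set.finite_range v
  | and _ _ h1 h2 => exact h1.union h2
  | or _ _ h1 h2 => exact h1.union h2
  | gdisj _ _ h1 h2 => exact h1.union h2
  | cneg _ h => exact h
  | ex v _ h => exact h.subset Set.sdiff_subset
  | al v _ h => exact h.subset Set.sdiff_subset

theorem fv_als (l : List ℕ) (φ : TS S ι ar) : fv (als l φ) = {x ∈ fv φ | x ∉ l} := by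
  induction l with
  | nil => simp [als]
  | cons v l ih =>
    change fv (als l φ) \ {v} = _
    rw [ih]; ext x; simp; tauto

/-- A variable list covering the free variables of `φ`. -/
noncomputable def fvList (φ : TS S ι ar) : List ℕ := (fv_finite φ).toFinset.toList

theorem isSentence_als_fvList (φ : TS S ι ar) : IsSentence (als (fvList φ) φ) := by
  simp [IsSentence, fv_als, fvList]

theorem tTrue_als {M : Type} {I : Interp S M} {A : ∀ i, Set (Fin (ar i) → M) → Prop}
    (l : List ℕ) (φ : TS S ι ar) : TTrue M I A (als l φ) ↔ TTrue M I A φ := by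
  unfold TTrue
  rw [tsat_als]
  have : {s' : ℕ → M | ∃ s ∈ Set.univ, AgreeOff l s s'} = Set.univ :=
    Set.eq_univ_of_forall fun s => ⟨s, trivial, .refl s⟩
  rw [this]

theorem fsat_congr {M : Type} {I : Interp S M} (φ : TS S ι ar) {s t : ℕ → M}
    (h : ∀ x ∈ fv φ, s x = t x) : FSat M I s φ ↔ FSat M I t φ := by
  induction φ generalizing s t with
  | rel r v =>
    have : (fun i => s (v i)) = fun i => t (v i) := funext fun i => h _ ⟨i, rfl⟩
    simp only [FSat, this]
  | nrel r v =>
    have : (fun i => s (v i)) = fun i => t (v i) := funext fun i => h _ ⟨i, rfl⟩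
    simp only [FSat, this]
  | eq x y => simp only [FSat, h x (Or.inl rfl), h y (Or.inr rfl)]
  | neq x y => simp only [FSat, h x (Or.inl rfl), h y (Or.inr rfl)]
  | dep i v => rfl
  | and _ _ h1 h2 =>
    exact and_congr (h1 fun x hx => h x (Or.inl hx)) (h2 fun x hx => h x (Or.inr hx))
  | or _ _ h1 h2 =>
    exact or_congr (h1 fun x hx => h x (Or.inl hx)) (h2 fun x hx => h x (Or.inr hx))
  | gdisj _ _ h1 h2 =>
    exact or_congr (h1 fun x hx => h x (Or.inl hx)) (h2 fun x hx => h x (Or.inr hx))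
  | cneg _ h1 => exact not_congr (h1 h)
  | ex v _ h1 =>
    refine exists_congr fun m => h1 fun x hx => ?_
    by_cases hv : x = v
    · subst hv; simp
    · rw [Function.update_of_ne hv, Function.update_of_ne hv]; exact h x ⟨hx, hv⟩
  | al v _ h1 =>
    refine forall_congr' fun m => h1 fun x hx => ?_
    by_cases hv : x = v
    · subst hv; simp
    · rw [Function.update_of_ne hv, Function.update_of_ne hv]; exact h x ⟨hx, hv⟩

theorem fsat_als {M : Type} {I : Interp S M} (l : List ℕ) (φ : TS S ι ar) (s : ℕ → M) :
    FSat M I s (als l φ) ↔ ∀ s', AgreeOff l s s' → FSat M I s' φ := by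
  induction l generalizing s with
  | nil => simp [als, AgreeOff.nil_iff]
  | cons v l ih =>
    change (∀ m, FSat M I _ (als l φ)) ↔ _
    simp only [ih, AgreeOff.cons_iff]
    constructor
    · rintro h s' ⟨m, e⟩; exact h m s' e
    · intro h m s' e; exact h s' ⟨m, e⟩

theorem fsat_exs {M : Type} {I : Interp S M} (l : List ℕ) (φ : TS S ι ar) (s : ℕ → M) :
    FSat M I s (exs l φ) ↔ ∃ s', AgreeOff l s s' ∧ FSat M I s' φ := by
  induction l generalizing s with
  | nil => simp [exs, AgreeOff.nil_iff]
  | cons v l ih =>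
    change (∃ m, FSat M I _ (exs l φ)) ↔ _
    simp only [ih, AgreeOff.cons_iff]
    constructor
    · rintro ⟨m, s', e, h⟩; exact ⟨s', ⟨m, e⟩, h⟩
    · rintro ⟨s', ⟨m, e⟩, h⟩; exact ⟨m, s', e, h⟩

/-- A class of structures is first-order definable (on domains with two elements). -/
def FODef (K : ∀ M : Type, Interp S M → Prop) : Prop :=
  ∃ ψ : FOF S, ∀ M : Type, Nontrivial M → ∀ (I : Interp S M) (s : ℕ → M),
    K M I ↔ FSat M I s ψ

theorem FODef.congr {K K' : ∀ M : Type, Interp S M → Prop} (h : FODef K)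
    (e : ∀ M : Type, Nontrivial M → ∀ I : Interp S M, K M I ↔ K' M I) : FODef K' := by
  obtain ⟨ψ, hψ⟩ := h
  exact ⟨ψ, fun M hM I s => (e M hM I).symm.trans (hψ M hM I s)⟩

theorem FODef.and {K K' : ∀ M : Type, Interp S M → Prop} (h : FODef K) (h' : FODef K') :
    FODef fun M I => K M I ∧ K' M I := by
  obtain ⟨ψ, hψ⟩ := h
  obtain ⟨ψ', hψ'⟩ := h'
  exact ⟨.and ψ ψ', fun M hM I s => and_congr (hψ M hM I s) (hψ' M hM I s)⟩

theorem FODef.or {K K' : ∀ M : Type, Interp S M → Prop} (h : FODef K) (h' : FODef K') :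
    FODef fun M I => K M I ∨ K' M I := by
  obtain ⟨ψ, hψ⟩ := h
  obtain ⟨ψ', hψ'⟩ := h'
  exact ⟨.or ψ ψ', fun M hM I s => or_congr (hψ M hM I s) (hψ' M hM I s)⟩

theorem FODef.true : FODef (S := S) fun _ _ => True :=
  ⟨.eq 0 0, fun M _ I s => by simp [FSat]⟩

theorem FODef.false : FODef (S := S) fun _ _ => False :=
  ⟨.neq 0 0, fun M _ I s => by simp [FSat]⟩

theorem FODef.exists_mem {α : Type*} (L : List α) {K : α → ∀ M : Type, Interp S M → Prop}
    (h : ∀ a ∈ L, FODef (K a)) : FODef fun M I => ∃ a ∈ L, K a M I := by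
  induction L with
  | nil => exact FODef.false.congr fun M _ I => by simp
  | cons a L ih =>
    exact ((h a (by simp)).or (ih fun b hb => h b (by simp [hb]))).congr fun M _ I => by simp

theorem FODef.forall_sat (θ : FOF S) : FODef fun M I => ∀ s, FSat M I s θ := by
  refine ⟨als (fvList θ) θ, fun M hM I s => ?_⟩
  rw [fsat_als]
  refine ⟨fun h s' _ => h s', fun h s' => ?_⟩
  classical
  refine (fsat_congr θ (t := fun x => if x ∈ fvList θ then s' x else s x) ?_).2
    (h _ fun x hx => by simp [hx])
  intro x hx
  simp [fvList, hx]

theorem sfoFam_iff {D : ∀ i, DepPred (ar i)} :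
    SFOFam D ↔ ∀ (S : Signature) (φ : TS S ι ar), Plain φ →
      FODef fun M I => TTrue M I (fun i => D i M) φ := by
  constructor
  · intro h S φ hφ
    obtain ⟨ψ, hs, hψ⟩ := h S _ (isSentence_als_fvList φ) (plain_als.2 hφ)
    refine ⟨ψ, fun M hM I s => ?_⟩
    change TTrue M I _ φ ↔ _
    rw [← tTrue_als (fvList φ), hψ M hM I]
    refine ⟨fun h => h s, fun h t => (fsat_congr ψ ?_).1 h⟩
    intro x hx
    rw [hs] at hx
    exact hx.elim
  · intro h S φ _ hφ
    obtain ⟨ψ, hψ⟩ := h S φ hφ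
    refine ⟨als (fvList ψ) ψ, isSentence_als_fvList ψ, fun M hM I => ?_⟩
    unfold FOTrue
    simp only [fsat_als]
    constructor
    · intro ht s s' _; exact (hψ M hM I s').1 ht
    · intro ht
      obtain ⟨m, -⟩ := exists_pair_ne M
      exact (hψ M hM I fun _ => m).2 (ht _ _ (.refl _))

/-- Add one `k`-ary relation symbol to a signature. -/
def SigAdd (S : Signature) (k : ℕ) : Signature := fun n => S n ⊕ PLift (n = k)

/-- Interpret the new symbol of `SigAdd S k` as `R`. -/
def addI {k : ℕ} {M : Type} (I : Interp S M) (R : Set (Fin k → M)) : Interp (SigAdd S k) M :=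
  fun n r => match r with
    | .inl r => I n r
    | .inr h => {s | (fun i => s (Fin.cast h.down.symm i)) ∈ R}

/-- The new symbol of `SigAdd S k`. -/
def newSym (S : Signature) (k : ℕ) : SigAdd S k k := .inr ⟨rfl⟩

/-- Rename relation symbols. -/
def mapSig {S' : Signature} (f : ∀ n, S n → S' n) : TS S ι ar → TS S' ι ar
  | .rel r v => .rel (f _ r) v
  | .nrel r v => .nrel (f _ r) v
  | .eq x y => .eq x y
  | .neq x y => .neq x y
  | .dep i v => .dep i v
  | .and φ ψ => .and (mapSig f φ) (mapSig f ψ)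
  | .or φ ψ => .or (mapSig f φ) (mapSig f ψ)
  | .gdisj φ ψ => .gdisj (mapSig f φ) (mapSig f ψ)
  | .cneg φ => .cneg (mapSig f φ)
  | .ex v φ => .ex v (mapSig f φ)
  | .al v φ => .al v (mapSig f φ)

theorem tsat_mapSig {S' : Signature} (f : ∀ n, S n → S' n) {M : Type} {I : Interp S' M}
    {A : ∀ i, Set (Fin (ar i) → M) → Prop} (φ : TS S ι ar) (X : Set (ℕ → M)) :
    TSat M I A (mapSig f φ) X ↔ TSat M (fun n r => I n (f n r)) A φ X := by
  induction φ generalizing X <;> simp_all only [TSat, mapSig]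

theorem plain_mapSig {S' : Signature} (f : ∀ n, S n → S' n) (φ : TS S ι ar) :
    Plain (mapSig f φ) ↔ Plain φ := by
  induction φ <;> simp_all only [Plain, mapSig, NoCneg, NoGdisj] <;> grind

/-- Substitute formulas for relation symbols. -/
def subRel {S' : Signature} (σ : ∀ n, S n → (Fin n → ℕ) → FOF S') : FOF S → FOF S'
  | .rel r v => σ _ r v
  | .nrel r v => .cneg (σ _ r v)
  | .eq x y => .eq x y
  | .neq x y => .neq x y
  | .dep i v => .dep i v
  | .and φ ψ => .and (subRel σ φ) (subRel σ ψ)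
  | .or φ ψ => .or (subRel σ φ) (subRel σ ψ)
  | .gdisj φ ψ => .gdisj (subRel σ φ) (subRel σ ψ)
  | .cneg φ => .cneg (subRel σ φ)
  | .ex v φ => .ex v (subRel σ φ)
  | .al v φ => .al v (subRel σ φ)

theorem fsat_subRel {S' : Signature} (σ : ∀ n, S n → (Fin n → ℕ) → FOF S') {M : Type}
    {I : Interp S M} {I' : Interp S' M}
    (h : ∀ n (r : S n) (v : Fin n → ℕ) (s : ℕ → M),
      FSat M I' s (σ n r v) ↔ (fun i => s (v i)) ∈ I n r)
    (φ : FOF S) (s : ℕ → M) : FSat M I' s (subRel σ φ) ↔ FSat M I s φ := by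
  induction φ generalizing s <;> simp_all only [FSat, subRel]

/-- Replace dependency atoms by formulas. -/
def bindDep {ι' : Type} {ar' : ι' → ℕ} (σ : ∀ i, (Fin (ar i) → ℕ) → TS S ι' ar') :
    TS S ι ar → TS S ι' ar'
  | .rel r v => .rel r v
  | .nrel r v => .nrel r v
  | .eq x y => .eq x y
  | .neq x y => .neq x y
  | .dep i v => σ i v
  | .and φ ψ => .and (bindDep σ φ) (bindDep σ ψ)
  | .or φ ψ => .or (bindDep σ φ) (bindDep σ ψ)
  | .gdisj φ ψ => .gdisj (bindDep σ φ) (bindDep σ ψ)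
  | .cneg φ => .cneg (bindDep σ φ)
  | .ex v φ => .ex v (bindDep σ φ)
  | .al v φ => .al v (bindDep σ φ)

theorem tsat_bindDep {ι' : Type} {ar' : ι' → ℕ} (σ : ∀ i, (Fin (ar i) → ℕ) → TS S ι' ar')
    {M : Type} {I : Interp S M} {A : ∀ i, Set (Fin (ar i) → M) → Prop}
    {A' : ∀ i, Set (Fin (ar' i) → M) → Prop}
    (h : ∀ i v X, TSat M I A' (σ i v) X ↔ A i (teamProj v X)) (φ : TS S ι ar)
    (X : Set (ℕ → M)) : TSat M I A' (bindDep σ φ) X ↔ TSat M I A φ X := by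
  induction φ generalizing X <;> simp_all only [TSat, bindDep]

theorem plain_bindDep {ι' : Type} {ar' : ι' → ℕ} {σ : ∀ i, (Fin (ar i) → ℕ) → TS S ι' ar'}
    (h : ∀ i v, Plain (σ i v)) {φ : TS S ι ar} (hφ : Plain φ) : Plain (bindDep σ φ) := by
  induction φ <;> simp_all [Plain, bindDep, NoCneg, NoGdisj]

theorem noCneg_bindDep {ι' : Type} {ar' : ι' → ℕ} {σ : ∀ i, (Fin (ar i) → ℕ) → TS S ι' ar'}
    (h : ∀ i v, NoCneg (σ i v)) {φ : TS S ι ar} (hφ : NoCneg φ) : NoCneg (bindDep σ φ) := by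
  induction φ <;> simp_all [bindDep, NoCneg]

/-- Rename variables along an injective map. -/
def ren (f : ℕ → ℕ) : TS S ι ar → TS S ι ar
  | .rel r v => .rel r fun i => f (v i)
  | .nrel r v => .nrel r fun i => f (v i)
  | .eq x y => .eq (f x) (f y)
  | .neq x y => .neq (f x) (f y)
  | .dep i v => .dep i fun j => f (v j)
  | .and φ ψ => .and (ren f φ) (ren f ψ)
  | .or φ ψ => .or (ren f φ) (ren f ψ)
  | .gdisj φ ψ => .gdisj (ren f φ) (ren f ψ)
  | .cneg φ => .cneg (ren f φ)
  | .ex v φ => .ex (f v) (ren f φ)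
  | .al v φ => .al (f v) (ren f φ)

theorem fsat_ren {f : ℕ → ℕ} (hf : Function.Injective f) {M : Type} {I : Interp S M}
    (φ : TS S ι ar) (s : ℕ → M) : FSat M I s (ren f φ) ↔ FSat M I (fun x => s (f x)) φ := by
  have hu : ∀ (s : ℕ → M) v m, (fun x => Function.update s (f v) m (f x)) =
      Function.update (fun x => s (f x)) v m := by
    intro s v m
    ext x
    by_cases h : x = v
    · subst h; simp
    · rw [Function.update_of_ne h, Function.update_of_ne (fun e => h (hf e))]
  induction φ generalizing s <;> simp_all only [FSat, ren]

end Basics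

section Ultraproduct

open Filter

variable {α : Type} (U : Ultrafilter α) {M : α → Type} {S : Signature} {ι : Type} {ar : ι → ℕ}

/-- The ultraproduct of a family of types. -/
abbrev UProd (M : α → Type) : Type := (U : Filter α).Product M

/-- The class of a representative. -/
def toU (a : ∀ n, M n) : UProd U M := Quotient.mk _ a

theorem exists_toU (x : UProd U M) : ∃ a, toU U a = x := Quotient.exists_rep x

theorem toU_eq {a b : ∀ n, M n} : toU U a = toU U b ↔ ∀ᶠ n in U, a n = b n := Quotient.eq

/-- The ultraproduct of a family of relations. -/
def ultRel {k : ℕ} (R : ∀ n, Set (Fin k → M n)) : Set (Fin k → UProd U M) :=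
  {t | ∃ a : Fin k → ∀ n, M n, (∀ j, t j = toU U (a j)) ∧ ∀ᶠ n in U, (fun j => a j n) ∈ R n}

theorem mem_ultRel {k : ℕ} {R : ∀ n, Set (Fin k → M n)} {a : Fin k → ∀ n, M n} :
    (fun j => toU U (a j)) ∈ ultRel U R ↔ ∀ᶠ n in U, (fun j => a j n) ∈ R n := by
  constructor
  · rintro ⟨b, hb, h⟩
    have := eventually_all.2 fun j => (toU_eq U).1 (hb j)
    filter_upwards [h, this] with n h1 h2
    rwa [show (fun j => a j n) = fun j => b j n from funext h2]
  · intro h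
    exact ⟨a, fun _ => rfl, h⟩

/-- The ultraproduct of a family of interpretations. -/
def ultI (I : ∀ n, Interp S (M n)) : Interp S (UProd U M) := fun k r => ultRel U fun n => I n k r

theorem toU_update (a : ℕ → ∀ n, M n) (v : ℕ) (b : ∀ n, M n) :
    Function.update (fun x => toU U (a x)) v (toU U b) =
      fun x => toU U (Function.update a v b x) := by
  ext x
  by_cases h : x = v
  · subst h; simp
  · simp [h]

theorem update_eval (a : ℕ → ∀ n, M n) (v : ℕ) (b : ∀ n, M n) (n : α) :
    (fun x => Function.update a v b x n) = Function.update (fun x => a x n) v (b n) := by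
  ext x
  by_cases h : x = v
  · subst h; simp
  · simp [h]

/-- Łoś's theorem. -/
theorem fsat_ult (I : ∀ n, Interp S (M n)) (φ : TS S ι ar) (a : ℕ → ∀ n, M n) :
    FSat (UProd U M) (ultI U I) (fun x => toU U (a x)) φ ↔
      ∀ᶠ n in U, FSat (M n) (I n) (fun x => a x n) φ := by
  induction φ generalizing a with
  | rel r v => exact mem_ultRel U
  | nrel r v => exact (not_congr (mem_ultRel U)).trans Ultrafilter.eventually_not.symm
  | eq x y => exact toU_eq U
  | neq x y => exact (not_congr (toU_eq U)).trans Ultrafilter.eventually_not.symm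
  | dep i v => simp [FSat]
  | and φ ψ h1 h2 => simp only [FSat, h1, h2, eventually_and]
  | or φ ψ h1 h2 => simp only [FSat, h1, h2, Ultrafilter.eventually_or]
  | gdisj φ ψ h1 h2 => simp only [FSat, h1, h2, Ultrafilter.eventually_or]
  | cneg φ h => simp only [FSat, h, Ultrafilter.eventually_not]
  | ex v φ h =>
    simp only [FSat]
    constructor
    · rintro ⟨m, hm⟩
      obtain ⟨b, rfl⟩ := exists_toU U m
      rw [toU_update, h] at hm
      filter_upwards [hm] with n hn
      exact ⟨b n, by rwa [update_eval] at hn⟩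
    · intro hm
      classical
      let b : ∀ n, M n := fun n =>
        if hn : ∃ m, FSat (M n) (I n) (Function.update (fun x => a x n) v m) φ then hn.choose
        else a 0 n
      refine ⟨toU U b, ?_⟩
      rw [toU_update, h]
      filter_upwards [hm] with n hn
      rw [update_eval]
      simp only [b, dif_pos hn]
      exact hn.choose_spec
  | al v φ h =>
    simp only [FSat]
    constructor
    · intro hm
      by_contra hc
      rw [← Ultrafilter.eventually_not] at hc
      classical
      let b : ∀ n, M n := fun n =>
        if hn : ∃ m, ¬ FSat (M n) (I n) (Function.update (fun x => a x n) v m) φ then hn.choose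
        else a 0 n
      have := hm (toU U b)
      rw [toU_update, h] at this
      obtain ⟨n, hn, hn'⟩ := (this.and hc).exists
      rw [update_eval] at hn
      have hn'' := not_forall.1 hn'
      simp only [b, dif_pos hn''] at hn
      exact hn''.choose_spec hn
    · intro hm m
      obtain ⟨b, rfl⟩ := exists_toU U m
      rw [toU_update, h]
      filter_upwards [hm] with n hn
      rw [update_eval]
      exact hn _

theorem nontrivial_uProd (h : ∀ n, Nontrivial (M n)) : Nontrivial (UProd U M) := by
  choose a b hab using fun n => exists_pair_ne (M n)
  refine ⟨toU U a, toU U b, fun e => ?_⟩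
  obtain ⟨n, hn⟩ := ((toU_eq U).1 e).exists
  exact hab n hn

theorem ultI_interpR {k : ℕ} (R : ∀ n, Set (Fin k → M n)) :
    ultI U (fun n => interpR (R n)) = interpR (ultRel U R) := by
  funext j ⟨e⟩
  subst e
  rfl

end Ultraproduct

section Termination

/-- The two-element family consisting of `D` and its complement. -/
def pairFam {k : ℕ} (D : DepPred k) : ∀ _ : Bool, DepPred k :=
  fun b => match b with | true => D | false => complD D

theorem tsat_guard {S : Signature} {ι : Type} {ar : ι → ℕ} {M : Type} {I : Interp S M}
    {A : ∀ i, Set (Fin (ar i) → M) → Prop} {n : ℕ} (r : S n) (w : Fin n → ℕ) (φ : TS S ι ar)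
    (X : Set (ℕ → M)) :
    TSat M I A (.or (.nrel r w) (.and (.rel r w) φ)) X ↔
      TSat M I A φ {s ∈ X | (fun i => s (w i)) ∈ I n r} := by
  constructor
  · rintro ⟨Y, Z, rfl, h1, h2, h3⟩
    have : {s ∈ Y ∪ Z | (fun i => s (w i)) ∈ I n r} = Z := by
      ext s
      constructor
      · rintro ⟨hY | hZ, h⟩
        · exact (h1 s hY h).elim
        · exact hZ
      · intro h; exact ⟨Or.inr h, h2 s h⟩
    rwa [this]
  · intro h
    refine ⟨{s ∈ X | (fun i => s (w i)) ∉ I n r}, _, ?_, fun s hs => hs.2, fun s hs => hs.2, h⟩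
    ext s
    by_cases hs : (fun i => s (w i)) ∈ I n r <;> simp [hs]

variable {k : ℕ}

/-- The relation symbol of `SigR k`. -/
def selfSym (k : ℕ) : SigR k k := ⟨rfl⟩

/-- The variables `k + i` followed by the variables `i`. -/
def twoVars (k : ℕ) : Fin (k + k) → ℕ :=
  Fin.append (fun i : Fin k => k + i) (fun i : Fin k => (i : ℕ))

/-- The union of a nonempty subfamily of the family of relations coded by a `2 * k`-ary relation
satisfies the dependency `b`. -/
def unionSentence (k : ℕ) (b : Bool) : TS (SigR (k + k)) Bool (fun _ => k) :=
  exs (List.range' k k) (als (List.range k)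
    (.or (.nrel (selfSym _) (twoVars k)) (.and (.rel (selfSym _) (twoVars k)) (.dep b fun i => i))))

theorem plain_unionSentence (b : Bool) : Plain (unionSentence k b) := by
  rw [unionSentence, plain_exs, plain_als]
  simp [Plain, NoCneg, NoGdisj]

theorem tTrue_unionSentence {M : Type} [Nonempty M] (A : Set (Fin (k + k) → M))
    (F : Bool → Set (Fin k → M) → Prop) (b : Bool) :
    TTrue M (interpR A) F (unionSentence k b) ↔
      ∃ Y : Set (Fin k → M), Y.Nonempty ∧ F b {x | ∃ y ∈ Y, Fin.append y x ∈ A} := by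
  have happ : ∀ s : ℕ → M, (fun i => s (twoVars k i)) =
      Fin.append (fun i : Fin k => s (k + i)) (fun i : Fin k => s i) := by
    intro s; funext i
    refine Fin.addCases (fun i => ?_) (fun i => ?_) i <;> simp [twoVars, -Fin.natAdd_eq_addNat]
  have hproj : ∀ X' : Set (ℕ → M),
      TSat M (interpR A) F (als (List.range k)
        (.or (.nrel (selfSym _) (twoVars k))
          (.and (.rel (selfSym _) (twoVars k)) (.dep b fun i => i)))) X' ↔
      F b {x | ∃ y ∈ teamProj (fun i : Fin k => k + i) X', Fin.append y x ∈ A} := by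
    intro X'
    rw [tsat_als, tsat_guard]
    change F b _ ↔ F b _
    have : teamProj (fun i : Fin k => (i : ℕ)) {s ∈ {s' | ∃ s ∈ X', AgreeOff (List.range k) s s'} |
          (fun i => s (twoVars k i)) ∈ interpR A (k + k) (selfSym _)} =
        {x | ∃ y ∈ teamProj (fun i : Fin k => k + i) X', Fin.append y x ∈ A} := by
      ext x
      constructor
      · rintro ⟨s', ⟨⟨s, hs, e⟩, h⟩, rfl⟩
        refine ⟨_, ⟨s, hs, rfl⟩, ?_⟩
        change (fun i => s' (twoVars k i)) ∈ A at h
        rw [happ] at h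
        rwa [show (fun i : Fin k => s (k + i)) = fun i : Fin k => s' (k + i) from
          funext fun i => (e _ (by simp)).symm]
      · rintro ⟨_, ⟨s, hs, rfl⟩, h⟩
        refine ⟨fun v => if hv : v < k then x ⟨v, hv⟩ else s v,
          ⟨⟨s, hs, fun v hv => ?_⟩, ?_⟩, ?_⟩
        · simp only [List.mem_range] at hv; simp [hv]
        · change (fun i => _) ∈ A
          rw [happ fun v => if hv : v < k then x ⟨v, hv⟩ else s v]
          simpa using h
        · simp
    rw [this]
  unfold TTrue unionSentence
  rw [tsat_exs]
  simp only [hproj]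
  constructor
  · rintro ⟨X', hX, h⟩
    refine ⟨_, ?_, h⟩
    obtain ⟨s, hs⟩ := hX.nonempty Set.univ_nonempty
    exact ⟨_, s, hs, rfl⟩
  · rintro ⟨Y, ⟨y0, hy0⟩, h⟩
    refine ⟨{s | (fun i : Fin k => s (k + i)) ∈ Y}, ⟨fun s _ => ⟨s, trivial, .refl s⟩, ?_⟩, ?_⟩
    · intro s _
      refine ⟨fun v => if hv : k ≤ v ∧ v < k + k then y0 ⟨v - k, by omega⟩ else s v, ?_, ?_⟩
      · simpa using hy0
      · intro v hv
        simp only [List.mem_range'_1] at hv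
        simp [hv]
    · have : teamProj (fun i : Fin k => k + i) {s | (fun i : Fin k => s (k + i)) ∈ Y} = Y := by
        ext y
        constructor
        · rintro ⟨s, hs, rfl⟩; exact hs
        · intro hy
          inhabit M
          refine ⟨fun v => if hv : k ≤ v ∧ v < k + k then y ⟨v - k, by omega⟩ else default,
            ?_, ?_⟩
          · simpa using hy
          · simp
      rwa [this]

/-- If `D` is doubly strongly first order, the length of chains alternating between the
complement of `D` and `D` is bounded. -/
theorem exists_chain_bound {D : DepPred k} (h : SFOFam (ar := fun _ => k) (pairFam D)) :
    ∃ n : ℕ, ∀ M : Type, Nontrivial M → ¬ ∃ Z : ℕ → Set (Fin k → M), Monotone Z ∧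
      ∀ j ≤ n, ¬ D M (Z (2 * j)) ∧ D M (Z (2 * j + 1)) := by
  by_contra hc
  push Not at hc
  choose M hM Z hZ hD using hc
  have hx : ∀ n j, j ≤ n → ∃ x, x ∈ Z n (2 * j + 1) ∧ x ∉ Z n (2 * j) := by
    intro n j hj
    by_contra hno
    push Not at hno
    have : Z n (2 * j) = Z n (2 * j + 1) :=
      Set.Subset.antisymm (hZ n (Nat.le_succ _)) hno
    exact (hD n j hj).1 (this ▸ (hD n j hj).2)
  choose x hx1 hx2 using hx
  have huniq : ∀ n i j y, y ∈ Z n (2 * i + 1) → y ∉ Z n (2 * j) → j ≤ i := by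
    intro n i j y h1 h2
    by_contra hlt
    exact h2 (hZ n (by omega) h1)
  classical
  let c : ∀ n, (Fin k → M n) → ℕ := fun n y =>
    if hy : ∃ j, j ≤ n ∧ y ∈ Z n (2 * j + 1) ∧ y ∉ Z n (2 * j) then hy.choose else 0
  have hcle : ∀ n y, c n y ≤ n := by
    intro n y
    by_cases hy : ∃ j, j ≤ n ∧ y ∈ Z n (2 * j + 1) ∧ y ∉ Z n (2 * j)
    · simp only [c, dif_pos hy]; exact hy.choose_spec.1
    · simp [c, dif_neg hy]
  have hcx : ∀ n j (hj : j ≤ n), c n (x n j hj) = j := by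
    intro n j hj
    have hy : ∃ i, i ≤ n ∧ x n j hj ∈ Z n (2 * i + 1) ∧ x n j hj ∉ Z n (2 * i) :=
      ⟨j, hj, hx1 n j hj, hx2 n j hj⟩
    simp only [c, dif_pos hy]
    exact le_antisymm (huniq n _ _ _ (hx1 n j hj) hy.choose_spec.2.2)
      (huniq n _ _ _ hy.choose_spec.2.1 (hx2 n j hj))
  let A : Bool → ∀ n, Set (Fin (k + k) → M n) := fun b n =>
    {t | (fun i => t (Fin.natAdd k i)) ∈
      Z n (2 * c n (fun i => t (Fin.castAdd k i)) + if b then 0 else 1)}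
  have hA : ∀ b n (y z : Fin k → M n),
      Fin.append y z ∈ A b n ↔ z ∈ Z n (2 * c n y + if b then 0 else 1) := by
    intro b n y z
    simp [A, -Fin.natAdd_eq_addNat]
  have hfalse : ∀ b n, ¬ TTrue (M n) (interpR (A b n)) (fun i => pairFam D i (M n))
      (unionSentence k b) := by
    intro b n
    have := hM n
    rw [tTrue_unionSentence]
    rintro ⟨Y, hY, h⟩
    have hfin : (c n '' Y).Finite :=
      (Set.finite_Iic n).subset (by rintro _ ⟨y, -, rfl⟩; exact hcle n y)
    obtain ⟨y0, hy0, hmax⟩ : ∃ y0 ∈ Y, ∀ y ∈ Y, c n y ≤ c n y0 := by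
      obtain ⟨_, ⟨y0, hy0, rfl⟩, hm⟩ := Set.exists_max_image _ id hfin (hY.image _)
      exact ⟨y0, hy0, fun y hy => hm _ ⟨y, hy, rfl⟩⟩
    have he : {z | ∃ y ∈ Y, Fin.append y z ∈ A b n} =
        Z n (2 * c n y0 + if b then 0 else 1) := by
      ext z
      simp only [hA, Set.mem_ofPred_eq]
      constructor
      · rintro ⟨y, hy, hz⟩
        exact hZ n (by have := hmax y hy; omega) hz
      · intro hz; exact ⟨y0, hy0, hz⟩
    rw [he] at h
    have := hD n _ (hcle n y0)
    cases b
    · exact h this.2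
    · exact this.1 h
  let U : Ultrafilter ℕ := Filter.hyperfilter ℕ
  have hU : ∀ j, ∀ᶠ n in (U : Filter ℕ), j ≤ n := fun j =>
    (Filter.eventually_ge_atTop j).filter_mono
      (Nat.hyperfilter_le_atTop)
  have hMU : Nontrivial (UProd U M) := nontrivial_uProd U hM
  have hult : ∀ b, ¬ TTrue (UProd U M) (interpR (ultRel U (A b)))
      (fun i => pairFam D i (UProd U M)) (unionSentence k b) := by
    intro b
    obtain ⟨ψ, hψ⟩ := sfoFam_iff.1 h _ _ (plain_unionSentence b)
    have a : ∀ n, M n := fun n => ((hM n).to_nonempty).some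
    intro hT
    have hT := (hψ _ hMU _ (fun _ => toU U a)).1 hT
    rw [← ultI_interpR, fsat_ult U _ ψ (fun _ => a)] at hT
    obtain ⟨n, hn⟩ := hT.exists
    exact hfalse b n ((hψ _ (hM n) _ _).2 hn)
  let y : ℕ → Fin k → ∀ n, M n := fun j i n => x n (min j n) (min_le_right _ _) i
  let Y : Set (Fin k → UProd U M) := Set.range fun j i => toU U (y j i)
  have hY : Y.Nonempty := ⟨_, 0, rfl⟩
  have hmem : ∀ b j (z : Fin k → ∀ n, M n),
      Fin.append (fun i => toU U (y j i)) (fun i => toU U (z i)) ∈ ultRel U (A b) ↔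
      ∀ᶠ n in (U : Filter ℕ), (fun i => z i n) ∈ Z n (2 * j + if b then 0 else 1) := by
    intro b j z
    have e1 : Fin.append (fun i => toU U (y j i)) (fun i => toU U (z i)) =
        fun i => toU U (Fin.append (y j) z i) := by
      funext i
      refine Fin.addCases (fun i => ?_) (fun i => ?_) i <;> simp [-Fin.natAdd_eq_addNat]
    rw [e1, mem_ultRel]
    refine Filter.eventually_congr ?_
    filter_upwards [hU j] with n hn
    have e2 : (fun i => Fin.append (y j) z i n) =
        Fin.append (fun i => y j i n) (fun i => z i n) := by
      funext i
      refine Fin.addCases (fun i => ?_) (fun i => ?_) i <;> simp [-Fin.natAdd_eq_addNat]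
    rw [e2, hA]
    have : c n (fun i => y j i n) = j := by
      exact (hcx n (min j n) (min_le_right _ _)).trans (min_eq_left hn)
    rw [this]
  have hun : {z | ∃ y ∈ Y, Fin.append y z ∈ ultRel U (A true)} =
      {z | ∃ y ∈ Y, Fin.append y z ∈ ultRel U (A false)} := by
    ext z
    choose z' hz' using fun i => exists_toU U (z i)
    obtain rfl : (fun i => toU U (z' i)) = z := funext hz'
    simp only [Set.mem_ofPred_eq, Y, Set.exists_range_iff, hmem]
    constructor
    · rintro ⟨j, hj⟩
      refine ⟨j, hj.mono fun n hn => hZ n (by simp) hn⟩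
    · rintro ⟨j, hj⟩
      refine ⟨j + 1, hj.mono fun n hn => hZ n (by simp [mul_add]) hn⟩
  have h1 : ¬ D (UProd U M) {z | ∃ y ∈ Y, Fin.append y z ∈ ultRel U (A true)} := fun hh =>
    hult true ((tTrue_unionSentence _ (fun i => pairFam D i (UProd U M)) true).2 ⟨Y, hY, hh⟩)
  exact hult false ((tTrue_unionSentence _ (fun i => pairFam D i (UProd U M)) false).2
    ⟨Y, hY, by rw [← hun]; exact h1⟩)

end Termination

section Lyndon

/-- First-order literals. -/
inductive Lit (S : Signature) : Type
  | rel {n : ℕ} (r : S n) (v : Fin n → ℕ)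
  | nrel {n : ℕ} (r : S n) (v : Fin n → ℕ)
  | eq (x y : ℕ)
  | neq (x y : ℕ)

/-- Formulas in which the relation variable `R` occurs only positively. -/
inductive Pos (S : Signature) (k : ℕ) : Type
  | base (l : Lit S)
  | R (v : Fin k → ℕ)
  | and (p q : Pos S k)
  | or (p q : Pos S k)
  | ex (v : ℕ) (p : Pos S k)
  | al (v : ℕ) (p : Pos S k)

variable {S : Signature} {k : ℕ}

/-- Satisfaction of literals. -/
def LSat (M : Type) (I : Interp S M) (s : ℕ → M) : Lit S → Prop
  | .rel r v => (fun i => s (v i)) ∈ I _ r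
  | .nrel r v => (fun i => s (v i)) ∉ I _ r
  | .eq x y => s x = s y
  | .neq x y => s x ≠ s y

/-- Satisfaction of positive formulas. -/
def PSat (M : Type) (I : Interp S M) (R : Set (Fin k → M)) : (ℕ → M) → Pos S k → Prop
  | s, .base l => LSat M I s l
  | s, .R v => (fun i => s (v i)) ∈ R
  | s, .and p q => PSat M I R s p ∧ PSat M I R s q
  | s, .or p q => PSat M I R s p ∨ PSat M I R s q
  | s, .ex v p => ∃ m, PSat M I R (Function.update s v m) p
  | s, .al v p => ∀ m, PSat M I R (Function.update s v m) p

/-- Finite conjunctions. -/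
def bigAnd (A : List (Pos S k)) : Pos S k := A.foldr .and (.base (.eq 0 0))

/-- Finite disjunctions. -/
def bigOr (A : List (Pos S k)) : Pos S k := A.foldr .or (.base (.neq 0 0))

theorem psat_bigAnd {M : Type} {I : Interp S M} {R : Set (Fin k → M)} {s : ℕ → M}
    (A : List (Pos S k)) : PSat M I R s (bigAnd A) ↔ ∀ p ∈ A, PSat M I R s p := by
  induction A with
  | nil => simp [bigAnd, PSat, LSat]
  | cons p A ih =>
    change PSat M I R s p ∧ PSat M I R s (bigAnd A) ↔ _
    simp [ih]

theorem psat_bigOr {M : Type} {I : Interp S M} {R : Set (Fin k → M)} {s : ℕ → M}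
    (A : List (Pos S k)) : PSat M I R s (bigOr A) ↔ ∃ p ∈ A, PSat M I R s p := by
  induction A with
  | nil => simp [bigOr, PSat, LSat]
  | cons p A ih =>
    change PSat M I R s p ∨ PSat M I R s (bigOr A) ↔ _
    simp [ih]

/-- The positive formulas of rank at most `q` built over the list `B`; the variable quantified
at rank `q` is `Q - q`. -/
def rankList (B : List (Pos S k)) (Q : ℕ) : ℕ → List (Pos S k)
  | 0 => B
  | q + 1 => rankList B Q q ++
      ((rankList B Q q).sublists.map (fun A => .ex (Q - (q + 1)) (bigAnd A)) ++
        (rankList B Q q).sublists.map (fun A => .al (Q - (q + 1)) (bigOr A)))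

/-- Every formula of `L` true in the first structure is true in the second one. -/
def Imp (L : List (Pos S k)) {M N : Type} (I : Interp S M) (R : Set (Fin k → M))
    (J : Interp S N) (T : Set (Fin k → N)) (s : ℕ → M) (t : ℕ → N) : Prop :=
  ∀ p ∈ L, PSat M I R s p → PSat N J T t p

section Game

variable {B : List (Pos S k)} {Q q : ℕ} {M N : Type} {I : Interp S M} {R : Set (Fin k → M)}
  {J : Interp S N} {T : Set (Fin k → N)} {s : ℕ → M} {t : ℕ → N}

theorem Imp.base (h : Imp (rankList B Q q) I R J T s t) : Imp B I R J T s t := by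
  induction q with
  | zero => exact h
  | succ q ih => exact ih fun p hp => h p (by simp [rankList, hp])

theorem Imp.forth (h : Imp (rankList B Q (q + 1)) I R J T s t) (m : M) :
    ∃ m', Imp (rankList B Q q) I R J T (Function.update s (Q - (q + 1)) m)
      (Function.update t (Q - (q + 1)) m') := by
  classical
  let A := (rankList B Q q).filter fun p => PSat M I R (Function.update s (Q - (q + 1)) m) p
  have hA : Pos.ex (Q - (q + 1)) (bigAnd A) ∈ rankList B Q (q + 1) := by
    simp only [rankList, List.mem_append, List.mem_map, List.mem_sublists]
    exact Or.inr (Or.inl ⟨A, List.filter_sublist, rfl⟩)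
  obtain ⟨m', hm'⟩ := h _ hA
    ⟨m, (psat_bigAnd A).2 fun p hp => by simpa [A] using (List.mem_filter.1 hp).2⟩
  rw [psat_bigAnd] at hm'
  exact ⟨m', fun p hp hs => hm' p (List.mem_filter.2 ⟨hp, by simpa using hs⟩)⟩

theorem Imp.back (h : Imp (rankList B Q (q + 1)) I R J T s t) (m' : N) :
    ∃ m, Imp (rankList B Q q) I R J T (Function.update s (Q - (q + 1)) m)
      (Function.update t (Q - (q + 1)) m') := by
  classical
  by_contra hc
  simp only [Imp, not_exists, not_forall] at hc
  let A := (rankList B Q q).filter fun p => ¬ PSat N J T (Function.update t (Q - (q + 1)) m') p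
  have hA : Pos.al (Q - (q + 1)) (bigOr A) ∈ rankList B Q (q + 1) := by
    simp only [rankList, List.mem_append, List.mem_map, List.mem_sublists]
    exact Or.inr (Or.inr ⟨A, List.filter_sublist, rfl⟩)
  have := h _ hA fun m => by
    obtain ⟨p, hp, hs, ht⟩ := hc m
    exact (psat_bigOr A).2 ⟨p, List.mem_filter.2 ⟨hp, by simpa using ht⟩, hs⟩
  obtain ⟨p, hp, hs⟩ := (psat_bigOr A).1 (this m')
  exact (by simpa using (List.mem_filter.1 hp).2 : ¬ _) hs

end Game

/-- The list of subformulas. -/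
def subs {S : Signature} : FOF S → List (FOF S)
  | .rel r v => [.rel r v]
  | .nrel r v => [.nrel r v]
  | .eq x y => [.eq x y]
  | .neq x y => [.neq x y]
  | .dep i v => [.dep i v]
  | .and φ ψ => .and φ ψ :: (subs φ ++ subs ψ)
  | .or φ ψ => .or φ ψ :: (subs φ ++ subs ψ)
  | .gdisj φ ψ => .gdisj φ ψ :: (subs φ ++ subs ψ)
  | .cneg φ => .cneg φ :: subs φ
  | .ex v φ => .ex v φ :: subs φ
  | .al v φ => .al v φ :: subs φ

theorem self_mem_subs (φ : FOF S) : φ ∈ subs φ := by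
  cases φ <;> simp [subs]

/-- The list of relation symbols of a formula. -/
def symList {S : Signature} : FOF S → List (Σ n, S n)
  | .rel r _ => [⟨_, r⟩]
  | .nrel r _ => [⟨_, r⟩]
  | .eq _ _ => []
  | .neq _ _ => []
  | .dep _ _ => []
  | .and φ ψ => symList φ ++ symList ψ
  | .or φ ψ => symList φ ++ symList ψ
  | .gdisj φ ψ => symList φ ++ symList ψ
  | .cneg φ => symList φ
  | .ex _ φ => symList φ
  | .al _ φ => symList φ

/-- The Tarski–Vaught test. -/
theorem fsat_iff_of_witness {A M : Type} {IA : Interp S A} {I : Interp S M} {e : A → M}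
    (he : Function.Injective e) (φ : FOF S)
    (hsym : ∀ n (r : S n), ⟨n, r⟩ ∈ symList φ → ∀ t, t ∈ IA n r ↔ (fun i => e (t i)) ∈ I n r)
    (hw : ∀ χ ∈ subs φ, ∀ v (s : ℕ → A),
      ((∃ m, FSat M I (Function.update (fun x => e (s x)) v m) χ) →
        ∃ a, FSat M I (Function.update (fun x => e (s x)) v (e a)) χ) ∧
      ((∃ m, ¬ FSat M I (Function.update (fun x => e (s x)) v m) χ) →
        ∃ a, ¬ FSat M I (Function.update (fun x => e (s x)) v (e a)) χ))
    (s : ℕ → A) : FSat A IA s φ ↔ FSat M I (fun x => e (s x)) φ := by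
  have hu : ∀ (s : ℕ → A) v a, (fun x => e (Function.update s v a x)) =
      Function.update (fun x => e (s x)) v (e a) := by
    intro s v a; ext x
    by_cases h : x = v
    · subst h; simp
    · simp [h]
  induction φ generalizing s with
  | rel r v => exact hsym _ r (by simp [symList]) _
  | nrel r v => exact not_congr (hsym _ r (by simp [symList]) _)
  | eq x y => exact he.eq_iff.symm
  | neq x y => exact not_congr he.eq_iff.symm
  | dep i v => exact i.elim
  | and φ ψ h1 h2 =>
    exact and_congr
      (h1 (fun n r hr => hsym n r (by simp [symList, hr]))
        (fun χ hχ => hw χ (by simp [subs, hχ])) s)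
      (h2 (fun n r hr => hsym n r (by simp [symList, hr]))
        (fun χ hχ => hw χ (by simp [subs, hχ])) s)
  | or φ ψ h1 h2 =>
    exact or_congr
      (h1 (fun n r hr => hsym n r (by simp [symList, hr]))
        (fun χ hχ => hw χ (by simp [subs, hχ])) s)
      (h2 (fun n r hr => hsym n r (by simp [symList, hr]))
        (fun χ hχ => hw χ (by simp [subs, hχ])) s)
  | gdisj φ ψ h1 h2 =>
    exact or_congr
      (h1 (fun n r hr => hsym n r (by simp [symList, hr]))
        (fun χ hχ => hw χ (by simp [subs, hχ])) s)
      (h2 (fun n r hr => hsym n r (by simp [symList, hr]))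
        (fun χ hχ => hw χ (by simp [subs, hχ])) s)
  | cneg φ h => exact not_congr (h hsym (fun χ hχ => hw χ (by simp [subs, hχ])) s)
  | ex v φ h =>
    have h := h hsym (fun χ hχ => hw χ (by simp [subs, hχ]))
    simp only [FSat, h, hu]
    exact ⟨fun ⟨a, ha⟩ => ⟨_, ha⟩, (hw φ (by simp [subs, self_mem_subs]) v s).1⟩
  | al v φ h =>
    have h := h hsym (fun χ hχ => hw χ (by simp [subs, hχ]))
    simp only [FSat, h, hu]
    refine ⟨fun ha => ?_, fun hm a => hm _⟩
    by_contra hc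
    obtain ⟨a, h'⟩ := (hw φ (by simp [subs, self_mem_subs]) v s).2 (not_forall.1 hc)
    exact h' (ha a)

/-- Literals in the variables below `Q` over the given relation symbols and `R`, the latter
only positively. -/
noncomputable def baseList (L : List (Σ n, S n)) (k Q : ℕ) : List (Pos S k) :=
  (L.flatMap fun r => (Finset.univ : Finset (Fin r.1 → Fin Q)).toList.flatMap fun v =>
      [.base (.rel r.2 fun i => v i), .base (.nrel r.2 fun i => v i)]) ++
  ((Finset.univ : Finset (Fin Q × Fin Q)).toList.flatMap fun v =>
      [.base (.eq v.1 v.2), .base (.neq v.1 v.2)]) ++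
  (Finset.univ : Finset (Fin k → Fin Q)).toList.map fun v => .R fun i => v i

theorem rel_mem_baseList {L : List (Σ n, S n)} {Q n : ℕ} {r : S n} (hr : ⟨n, r⟩ ∈ L)
    (v : Fin n → ℕ) (hv : ∀ i, v i < Q) :
    Pos.base (.rel r v) ∈ baseList L k Q ∧ Pos.base (.nrel r v) ∈ baseList L k Q := by
  simp only [baseList, List.mem_append, List.mem_flatMap]
  exact ⟨Or.inl (Or.inl ⟨_, hr, fun i => ⟨v i, hv i⟩, by simp, by simp⟩),
    Or.inl (Or.inl ⟨_, hr, fun i => ⟨v i, hv i⟩, by simp, by simp⟩)⟩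

theorem eq_mem_baseList {L : List (Σ n, S n)} {Q x y : ℕ} (hx : x < Q) (hy : y < Q) :
    Pos.base (.eq x y) ∈ baseList L k Q ∧ Pos.base (.neq x y) ∈ baseList L k Q := by
  simp only [baseList, List.mem_append, List.mem_flatMap]
  exact ⟨Or.inl (Or.inr ⟨(⟨x, hx⟩, ⟨y, hy⟩), by simp, by simp⟩),
    Or.inl (Or.inr ⟨(⟨x, hx⟩, ⟨y, hy⟩), by simp, by simp⟩)⟩

theorem R_mem_baseList {L : List (Σ n, S n)} {Q : ℕ} (v : Fin k → ℕ) (hv : ∀ i, v i < Q) :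
    Pos.R v ∈ baseList L k Q := by
  simp only [baseList, List.mem_append, List.mem_map]
  exact Or.inr ⟨fun i => ⟨v i, hv i⟩, by simp, rfl⟩

end Lyndon

section LyndonSequence

variable {S : Signature} {k : ℕ}

theorem baseList_congr {L : List (Σ n, S n)} {Q : ℕ} {p : Pos S k} (hp : p ∈ baseList L k Q)
    {M : Type} {I : Interp S M} {R : Set (Fin k → M)} {s s' : ℕ → M}
    (h : ∀ x < Q, s x = s' x) : PSat M I R s p ↔ PSat M I R s' p := by
  have h' : ∀ x : Fin Q, s x = s' x := fun x => h x x.2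
  simp only [baseList, List.mem_append, List.mem_flatMap, List.mem_map, List.mem_cons,
    List.not_mem_nil, or_false] at hp
  rcases hp with (⟨r, -, v, -, rfl | rfl⟩ | ⟨v, -, rfl | rfl⟩) | ⟨v, -, rfl⟩ <;>
    simp only [PSat, LSat, h']

/-- If the formula `χ` has a witness for the variable `v`, then `m` is one; the parameters are
the values of `s` at the indices in `w`. -/
def Wit {M : Type} (I : Interp S M) (χ : FOF S) (s : ℕ → M) (v : ℕ) (w : List ℕ) (m : M) : Prop :=
  (∃ m', FSat M I (Function.update (fun y => s (w.getD y 0)) v m') χ) →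
    FSat M I (Function.update (fun y => s (w.getD y 0)) v m) χ

theorem exists_wit {M : Type} [Nonempty M] (I : Interp S M) (χ : FOF S) (s : ℕ → M) (v : ℕ)
    (w : List ℕ) : ∃ m, Wit I χ s v w m := by
  by_cases h : ∃ m', FSat M I (Function.update (fun y => s (w.getD y 0)) v m') χ
  · exact ⟨h.choose, fun _ => h.choose_spec⟩
  · exact ⟨Classical.arbitrary M, fun h' => (h h').elim⟩

/-- The requirement treated at step `n`: a side, a variable, an index of a formula, and a list
of parameters. -/
def challenge (n : ℕ) : Bool × ℕ × ℕ × List ℕ :=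
  (Encodable.decode n.unpair.2).getD (true, 0, 0, [])

/-- The formula referred to by the `n`-th challenge. -/
def chFormula (C : List (FOF S)) (j : ℕ) : FOF S := C.getD j (.eq 0 0)

theorem exists_sequences {B : List (Pos S k)} {Q : ℕ} {M N : Type} [Nonempty M] [Nonempty N]
    {I : Interp S M} {R : Set (Fin k → M)} {J : Interp S N} {T : Set (Fin k → N)}
    {s : ℕ → M} {t : ℕ → N} (h : Imp (rankList B Q Q) I R J T s t)
    (C : List (FOF (SigAdd S k))) :
    ∃ (a : ℕ → M) (b : ℕ → N),
      (∃ s' t', (∀ x < Q, s' x = a x ∧ t' x = b x) ∧ Imp B I R J T s' t') ∧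
      ∀ n, 0 < n → (∀ x ∈ (challenge n).2.2.2, x < n) →
        ((challenge n).1 = true → Wit (addI I R) (chFormula C (challenge n).2.2.1) a
          (challenge n).2.1 (challenge n).2.2.2 (a n)) ∧
        ((challenge n).1 = false → Wit (addI J T) (chFormula C (challenge n).2.2.1) b
          (challenge n).2.1 (challenge n).2.2.2 (b n)) := by
  have step : ∀ (n : ℕ) (st : (ℕ → M) × (ℕ → N)), ∃ m : M × N,
      (n < Q → Imp (rankList B Q (Q - n)) I R J T st.1 st.2 →
        Imp (rankList B Q (Q - (n + 1))) I R J T (Function.update st.1 n m.1)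
          (Function.update st.2 n m.2)) ∧
      ((challenge n).1 = true → Wit (addI I R) (chFormula C (challenge n).2.2.1) st.1
          (challenge n).2.1 (challenge n).2.2.2 m.1) ∧
      ((challenge n).1 = false → Wit (addI J T) (chFormula C (challenge n).2.2.1) st.2
          (challenge n).2.1 (challenge n).2.2.2 m.2) := by
    rintro n ⟨s, t⟩
    obtain ⟨m, hm⟩ := exists_wit (addI I R) (chFormula C (challenge n).2.2.1) s
      (challenge n).2.1 (challenge n).2.2.2
    obtain ⟨m', hm'⟩ := exists_wit (addI J T) (chFormula C (challenge n).2.2.1) t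
      (challenge n).2.1 (challenge n).2.2.2
    by_cases hQ : n < Q ∧ Imp (rankList B Q (Q - n)) I R J T s t
    · obtain ⟨hn, hI⟩ := hQ
      obtain ⟨q, hq⟩ : ∃ q, Q - n = q + 1 := ⟨Q - n - 1, by omega⟩
      have e1 : Q - (n + 1) = q := by omega
      have e2 : Q - (q + 1) = n := by omega
      rw [hq] at hI
      cases hb : (challenge n).1
      · obtain ⟨m1, h1⟩ := hI.back m'
        rw [e2] at h1
        exact ⟨(m1, m'), fun _ _ => by rwa [e1], by simp, fun _ => hm'⟩
      · obtain ⟨m1, h1⟩ := hI.forth m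
        rw [e2] at h1
        exact ⟨(m, m1), fun _ _ => by rwa [e1], fun _ => hm, by simp⟩
    · exact ⟨(m, m'), fun h1 h2 => (hQ ⟨h1, h2⟩).elim, fun _ => hm, fun _ => hm'⟩
  choose f hf1 hf2 hf3 using step
  let st : ℕ → (ℕ → M) × (ℕ → N) := fun n => Nat.rec (s, t)
    (fun n p => (Function.update p.1 n (f n p).1, Function.update p.2 n (f n p).2)) n
  have hst : ∀ n, st (n + 1) = (Function.update (st n).1 n (f n (st n)).1,
    Function.update (st n).2 n (f n (st n)).2) := fun n => rfl
  have hstab : ∀ n x, x < n → (st n).1 x = (st (x + 1)).1 x ∧ (st n).2 x = (st (x + 1)).2 x := by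
    intro n x hx
    induction n, hx using Nat.le_induction with
    | base => exact ⟨rfl, rfl⟩
    | succ n hn ih =>
      have hne : x ≠ n := by omega
      rw [hst]
      simpa [hne] using ih
  refine ⟨fun x => (st (x + 1)).1 x, fun x => (st (x + 1)).2 x, ⟨(st Q).1, (st Q).2,
    fun x hx => hstab Q x hx, ?_⟩, ?_⟩
  · have : ∀ n ≤ Q, Imp (rankList B Q (Q - n)) I R J T (st n).1 (st n).2 := by
      intro n
      induction n with
      | zero => exact fun _ => h
      | succ n ih => exact fun hn => hf1 n (st n) hn (ih (by omega))
    exact (this Q le_rfl).base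
  · intro n hn hw
    have hlt : ∀ y, (challenge n).2.2.2.getD y 0 < n := by
      intro y
      rw [List.getD_eq_getElem?_getD]
      by_cases hy : y < (challenge n).2.2.2.length
      · rw [List.getElem?_eq_getElem hy]; exact hw _ (List.getElem_mem hy)
      · rw [List.getElem?_eq_none (by omega)]; exact hn
    constructor
    · intro hb
      have := hf2 n (st n) hb
      simp only [Wit, (hstab n _ (hlt _)).1] at this
      simpa [Wit, hst] using this
    · intro hb
      have := hf3 n (st n) hb
      simp only [Wit, (hstab n _ (hlt _)).2] at this
      simpa [Wit, hst] using this

theorem ult_witness (U : Ultrafilter ℕ) {M : ℕ → Type} (I : ∀ Q, Interp S (M Q))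
    (a : ∀ Q, ℕ → M Q) (χ : FOF S) {v : ℕ}
    (hw : ∀ w : List ℕ, ∃ n, ∀ Q, Wit (I Q) χ (a Q) v w (a Q n)) (σ : ℕ → ℕ)
    (h : ∃ m, FSat (UProd U M) (ultI U I)
      (Function.update (fun y => toU U fun Q => a Q (σ y)) v m) χ) :
    ∃ n, FSat (UProd U M) (ultI U I)
      (Function.update (fun y => toU U fun Q => a Q (σ y)) v (toU U fun Q => a Q n)) χ := by
  obtain ⟨bd, hbd⟩ : ∃ bd, ∀ x ∈ fv χ, x < bd := by
    obtain ⟨b, hb⟩ := (fv_finite χ).bddAbove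
    exact ⟨b + 1, fun x hx => Nat.lt_succ_of_le (hb hx)⟩
  let w := (List.range bd).map σ
  have hwσ : ∀ x ∈ fv χ, w.getD x 0 = σ x := by
    intro x hx
    simp [w, List.getD_eq_getElem?_getD, hbd x hx]
  have hcongr : ∀ Q m, FSat (M Q) (I Q) (Function.update (fun y => a Q (σ y)) v m) χ ↔
      FSat (M Q) (I Q) (Function.update (fun y => a Q (w.getD y 0)) v m) χ := by
    intro Q m
    refine fsat_congr χ fun x hx => ?_
    by_cases hv : x = v
    · subst hv; simp
    · simp only [Function.update_of_ne hv]; rw [hwσ x hx]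
  obtain ⟨n, hn⟩ := hw w
  refine ⟨n, ?_⟩
  obtain ⟨m, hm⟩ := h
  obtain ⟨b, rfl⟩ := exists_toU U m
  rw [toU_update U (fun y Q => a Q (σ y)), fsat_ult U I] at hm ⊢
  filter_upwards [hm] with Q hQ
  rw [update_eval (fun y Q => a Q (σ y)), hcongr] at hQ ⊢
  exact hn Q ⟨_, hQ⟩

end LyndonSequence

section LyndonTheorem

variable {S : Signature} {k : ℕ}

/-- The class `K` of expansions by a `k`-ary relation is first-order definable. -/
def RDef (K : ∀ M : Type, Interp S M → Set (Fin k → M) → Prop) : Prop :=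
  ∃ ψ : FOF (SigAdd S k), ∀ M : Type, Nontrivial M → ∀ (I : Interp S M) (R : Set (Fin k → M))
    (s : ℕ → M), K M I R ↔ FSat M (addI I R) s ψ

/-- `K` is monotone in its relation argument. -/
def MonoR (K : ∀ M : Type, Interp S M → Set (Fin k → M) → Prop) : Prop :=
  ∀ M : Type, Nontrivial M → ∀ (I : Interp S M) (R R' : Set (Fin k → M)), R ⊆ R' →
    K M I R → K M I R'

/-- The symbols of the original signature occurring in a formula over `SigAdd S k`. -/
def oldSyms (ψ : FOF (SigAdd S k)) : List (Σ n, S n) :=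
  (symList ψ).filterMap fun r => match r with
    | ⟨n, .inl r⟩ => some ⟨n, r⟩
    | ⟨_, .inr _⟩ => none

theorem mem_oldSyms {ψ : FOF (SigAdd S k)} {n : ℕ} {r : S n}
    (h : (⟨n, .inl r⟩ : Σ n, SigAdd S k n) ∈ symList ψ) : ⟨n, r⟩ ∈ oldSyms ψ :=
  List.mem_filterMap.2 ⟨_, h, rfl⟩

/-- There cannot be, for every rank, a model and a countermodel of a formula which is monotone in
the new symbol such that all positive formulas of that rank transfer from the former to the
latter. -/
theorem no_separating_sequence {K : ∀ M : Type, Interp S M → Set (Fin k → M) → Prop}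
    {ψ : FOF (SigAdd S k)}
    (hψ : ∀ M : Type, Nontrivial M → ∀ (I : Interp S M) (R : Set (Fin k → M)) (s : ℕ → M),
      K M I R ↔ FSat M (addI I R) s ψ) (hK : MonoR K)
    (M N : ℕ → Type) (hM : ∀ Q, Nontrivial (M Q)) (hN : ∀ Q, Nontrivial (N Q))
    (I : ∀ Q, Interp S (M Q)) (J : ∀ Q, Interp S (N Q))
    (R : ∀ Q, Set (Fin k → M Q)) (T : ∀ Q, Set (Fin k → N Q))
    (s : ∀ Q, ℕ → M Q) (t : ∀ Q, ℕ → N Q)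
    (hs : ∀ Q, K (M Q) (I Q) (R Q)) (ht : ∀ Q, ¬ K (N Q) (J Q) (T Q))
    (h : ∀ Q, Imp (rankList (baseList (oldSyms ψ) k Q) Q Q) (I Q) (R Q) (J Q) (T Q) (s Q) (t Q)) :
    False := by
  let C : List (FOF (SigAdd S k)) := .neq 0 1 :: (subs ψ ++ (subs ψ).map .cneg)
  choose a b h1 h2 using fun Q =>
    have := (hM Q).to_nonempty
    have := (hN Q).to_nonempty
    exists_sequences (h Q) C
  have hImp : ∀ Q, Imp (baseList (oldSyms ψ) k Q) (I Q) (R Q) (J Q) (T Q) (a Q) (b Q) := by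
    intro Q p hp hpa
    obtain ⟨s', t', he, hI⟩ := h1 Q
    exact (baseList_congr hp fun x hx => (he x hx).2).1
      (hI p hp ((baseList_congr hp fun x hx => (he x hx).1).2 hpa))
  have hnum : ∀ (side : Bool) (v j : ℕ) (w : List ℕ), ∃ n, 0 < n ∧ challenge n = (side, v, j, w) ∧
      ∀ x ∈ w, x < n := by
    intro side v j w
    refine ⟨Nat.pair (w.sum + 1) (Encodable.encode (side, v, j, w)), ?_, ?_, ?_⟩
    · exact lt_of_lt_of_le (Nat.succ_pos _) (Nat.left_le_pair _ _)
    · simp [challenge]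
    · intro x hx
      exact lt_of_lt_of_le (Nat.lt_succ_of_le (List.single_le_sum (by simp) x hx))
        (Nat.left_le_pair _ _)
  have hwa : ∀ χ ∈ C, ∀ v (w : List ℕ), ∃ n, ∀ Q, Wit (addI (I Q) (R Q)) χ (a Q) v w (a Q n) := by
    intro χ hχ v w
    obtain ⟨j, hj, rfl⟩ := List.getElem_of_mem hχ
    obtain ⟨n, hn, hc, hw⟩ := hnum true v j w
    refine ⟨n, fun Q => ?_⟩
    have := (h2 Q n hn (by rw [hc]; exact hw)).1 (by rw [hc])
    rw [hc] at this
    simpa [chFormula, List.getD_eq_getElem?_getD, hj] using this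
  have hwb : ∀ χ ∈ C, ∀ v (w : List ℕ), ∃ n, ∀ Q, Wit (addI (J Q) (T Q)) χ (b Q) v w (b Q n) := by
    intro χ hχ v w
    obtain ⟨j, hj, rfl⟩ := List.getElem_of_mem hχ
    obtain ⟨n, hn, hc, hw⟩ := hnum false v j w
    refine ⟨n, fun Q => ?_⟩
    have := (h2 Q n hn (by rw [hc]; exact hw)).2 (by rw [hc])
    rw [hc] at this
    simpa [chFormula, List.getD_eq_getElem?_getD, hj] using this
  let U : Ultrafilter ℕ := Filter.hyperfilter ℕ
  have hU : ∀ j, ∀ᶠ n in (U : Filter ℕ), j < n := fun j =>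
    (Filter.eventually_gt_atTop j).filter_mono Nat.hyperfilter_le_atTop
  let α : ℕ → UProd U M := fun x => toU U fun Q => a Q x
  let β : ℕ → UProd U N := fun x => toU U fun Q => b Q x
  let IM := ultI U fun Q => addI (I Q) (R Q)
  let IN := ultI U fun Q => addI (J Q) (T Q)
  have hvars : ∀ {n : ℕ} (v : Fin n → ℕ), ∀ᶠ Q in (U : Filter ℕ), ∀ i, v i < Q := fun v =>
    Filter.eventually_all.2 fun i => hU (v i)
  have hrel : ∀ {n : ℕ} {r : S n}, ⟨n, .inl r⟩ ∈ symList ψ → ∀ v : Fin n → ℕ,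
      ((fun i => α (v i)) ∈ IM n (.inl r) ↔ (fun i => β (v i)) ∈ IN n (.inl r)) := by
    intro n r hr v
    refine (mem_ultRel U (a := fun i Q => a Q (v i))).trans
      (Iff.trans ?_ (mem_ultRel U (a := fun i Q => b Q (v i))).symm)
    refine Filter.eventually_congr ?_
    filter_upwards [hvars v] with Q hQ
    have hm := rel_mem_baseList (k := k) (mem_oldSyms hr) v hQ
    exact ⟨hImp Q _ hm.1, fun hb => by_contra fun ha => hImp Q _ hm.2 ha hb⟩
  have hR : ∀ v : Fin k → ℕ, (fun i => α (v i)) ∈ IM k (newSym S k) →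
      (fun i => β (v i)) ∈ IN k (newSym S k) := by
    intro v hv
    refine (mem_ultRel U (a := fun i Q => b Q (v i))).2 ?_
    filter_upwards [(mem_ultRel U (a := fun i Q => a Q (v i))).1 hv, hvars v] with Q h' hQ
    exact hImp Q _ (R_mem_baseList v hQ) h'
  have heq : ∀ x y, α x = α y ↔ β x = β y := by
    intro x y
    refine (toU_eq U).trans (Iff.trans ?_ (toU_eq U).symm)
    refine Filter.eventually_congr ?_
    filter_upwards [hU x, hU y] with Q hx hy
    have hm := eq_mem_baseList (k := k) (L := oldSyms ψ) hx hy
    exact ⟨hImp Q _ hm.1, fun hb => by_contra fun ha => hImp Q _ hm.2 ha hb⟩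
  let A : Type := Set.range fun x => (α x, β x)
  let el : ℕ → A := fun x => ⟨(α x, β x), x, rfl⟩
  have hel : ∀ y : A, ∃ x, el x = y := by
    rintro ⟨_, x, rfl⟩; exact ⟨x, rfl⟩
  let e1 : A → UProd U M := fun y => y.1.1
  let e2 : A → UProd U N := fun y => y.1.2
  have he1 : Function.Injective e1 := by
    intro y z hyz
    obtain ⟨x, rfl⟩ := hel y
    obtain ⟨x', rfl⟩ := hel z
    exact Subtype.ext (Prod.ext hyz ((heq x x').1 hyz))
  have he2 : Function.Injective e2 := by
    intro y z hyz
    obtain ⟨x, rfl⟩ := hel y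
    obtain ⟨x', rfl⟩ := hel z
    exact Subtype.ext (Prod.ext ((heq x x').2 hyz) hyz)
  have hw1 : ∀ χ ∈ C, ∀ v (s : ℕ → A),
      (∃ m, FSat _ IM (Function.update (fun x => e1 (s x)) v m) χ) →
        ∃ y, FSat _ IM (Function.update (fun x => e1 (s x)) v (e1 y)) χ := by
    intro χ hχ v s hm
    choose σ hσ using fun x => hel (s x)
    obtain rfl : (fun x => el (σ x)) = s := funext hσ
    obtain ⟨n, hn⟩ := ult_witness U _ a χ (hwa χ hχ v) σ hm
    exact ⟨el n, hn⟩
  have hw2 : ∀ χ ∈ C, ∀ v (s : ℕ → A),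
      (∃ m, FSat _ IN (Function.update (fun x => e2 (s x)) v m) χ) →
        ∃ y, FSat _ IN (Function.update (fun x => e2 (s x)) v (e2 y)) χ := by
    intro χ hχ v s hm
    choose σ hσ using fun x => hel (s x)
    obtain rfl : (fun x => el (σ x)) = s := funext hσ
    obtain ⟨n, hn⟩ := ult_witness U _ b χ (hwb χ hχ v) σ hm
    exact ⟨el n, hn⟩
  have hA : Nontrivial A := by
    have := nontrivial_uProd U hM
    obtain ⟨m, hm⟩ := exists_ne (e1 (el 0))
    obtain ⟨y, hy⟩ := hw1 (.neq 0 1) (by simp [C]) 1 (fun _ => el 0)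
      ⟨m, by simpa [FSat] using hm.symm⟩
    simp only [FSat, Function.update_self, ne_eq, zero_ne_one, not_false_eq_true,
      Function.update_of_ne] at hy
    exact ⟨el 0, y, fun e => hy (by rw [e])⟩
  have hC : ∀ χ ∈ subs ψ, χ ∈ C ∧ TS.cneg χ ∈ C := by
    intro χ hχ; simp [C, hχ]
  let IA : Interp S A := fun n r => {t | (fun i => e1 (t i)) ∈ IM n (.inl r)}
  let RA : Set (Fin k → A) := {t | (fun i => e1 (t i)) ∈ IM k (newSym S k)}
  let SA : Set (Fin k → A) := {t | (fun i => e2 (t i)) ∈ IN k (newSym S k)}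
  have hsub : RA ⊆ SA := by
    intro t ht
    choose σ hσ using fun x => hel (t x)
    obtain rfl : (fun x => el (σ x)) = t := funext hσ
    exact hR σ ht
  have f1 := fsat_iff_of_witness (IA := addI IA RA) (I := IM) he1 ψ (by
      rintro n (r | ⟨⟨rfl⟩⟩) hr t
      · rfl
      · rfl) (fun χ hχ v s => ⟨hw1 χ (hC χ hχ).1 v s, hw1 _ (hC χ hχ).2 v s⟩) (fun _ => el 0)
  have f2 := fsat_iff_of_witness (IA := addI IA SA) (I := IN) he2 ψ (by
      rintro n (r | ⟨⟨rfl⟩⟩) hr t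
      · choose σ hσ using fun x => hel (t x)
        obtain rfl : (fun x => el (σ x)) = t := funext hσ
        exact hrel hr σ
      · rfl) (fun χ hχ v s => ⟨hw2 χ (hC χ hχ).1 v s, hw2 _ (hC χ hχ).2 v s⟩) (fun _ => el 0)
  have k1 : K A IA RA := by
    refine (hψ A hA IA RA fun _ => el 0).2 (f1.2 ?_)
    refine (fsat_ult U _ ψ fun _ Q => a Q 0).2 (.of_forall fun Q => ?_)
    exact (hψ _ (hM Q) _ _ _).1 (hs Q)
  have k2 := (hψ A hA IA SA fun _ => el 0).1 (hK A hA IA RA SA hsub k1)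
  obtain ⟨Q, hQ⟩ := ((fsat_ult U _ ψ fun _ Q => b Q 0).1 (f2.1 k2)).exists
  exact ht Q ((hψ _ (hN Q) _ _ _).2 hQ)

/-- Lyndon's theorem: a definable class that is monotone in a relation is defined by a formula
in which that relation occurs only positively. -/
theorem exists_pos_of_monoR {K : ∀ M : Type, Interp S M → Set (Fin k → M) → Prop}
    (hd : RDef K) (hK : MonoR K) :
    ∃ p : Pos S k, ∀ M : Type, Nontrivial M → ∀ (I : Interp S M) (R : Set (Fin k → M))
      (s : ℕ → M), K M I R ↔ PSat M I R s p := by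
  classical
  obtain ⟨ψ, hψ⟩ := hd
  by_contra hc
  let L : ℕ → List (Pos S k) := fun Q => rankList (baseList (oldSyms ψ) k Q) Q Q
  let P : ℕ → List (Pos S k) → Prop := fun Q F => ∃ M : Type, Nontrivial M ∧
    ∃ (I : Interp S M) (R : Set (Fin k → M)) (s : ℕ → M), K M I R ∧
      F = (L Q).filter fun p => PSat M I R s p
  let p : ℕ → Pos S k := fun Q => bigOr (((L Q).sublists.filter fun F => P Q F).map bigAnd)
  have hp : ∀ Q, ∃ N : Type, Nontrivial N ∧ ∃ (J : Interp S N) (T : Set (Fin k → N)) (t : ℕ → N),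
      PSat N J T t (p Q) ∧ ¬ K N J T := by
    intro Q
    by_contra hno
    refine hc ⟨p Q, fun M hM I R s => ⟨fun hk => ?_, fun hps => ?_⟩⟩
    · rw [psat_bigOr]
      refine ⟨bigAnd ((L Q).filter fun p => PSat M I R s p), List.mem_map.2 ⟨_, ?_, rfl⟩, ?_⟩
      · refine List.mem_filter.2 ⟨List.mem_sublists.2 List.filter_sublist, ?_⟩
        simpa using ⟨M, hM, I, R, s, hk, rfl⟩
      · rw [psat_bigAnd]
        intro q hq
        simpa using (List.mem_filter.1 hq).2
    · by_contra hk
      exact hno ⟨M, hM, I, R, s, hps, hk⟩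
  choose N hN J T t ht1 ht2 using hp
  have hp' : ∀ Q, ∃ M : Type, Nontrivial M ∧ ∃ (I : Interp S M) (R : Set (Fin k → M)) (s : ℕ → M),
      K M I R ∧ Imp (L Q) I R (J Q) (T Q) s (t Q) := by
    intro Q
    have h := ht1 Q
    rw [psat_bigOr] at h
    obtain ⟨_, hF, h⟩ := h
    obtain ⟨F, hF', rfl⟩ := List.mem_map.1 hF
    obtain ⟨M, hM, I, R, s, hk, rfl⟩ := of_decide_eq_true (List.mem_filter.1 hF').2
    refine ⟨M, hM, I, R, s, hk, fun q hq hs => ?_⟩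
    exact (psat_bigAnd _).1 h q (List.mem_filter.2 ⟨hq, by simpa using hs⟩)
  choose M hM I R s hs1 hs2 using hp'
  exact no_separating_sequence hψ hK M N hM hN I J R T s t hs1 ht2 hs2

end LyndonTheorem

section Flat

variable {S : Signature} {ι : Type} {ar : ι → ℕ} {M : Type} {I : Interp S M} {k : ℕ}

theorem tsat_iff_forall_fsat {φ : FOF S} (hφ : Plain φ)
    {A : ∀ i, Set (Fin (noAtoms i) → M) → Prop} (X : Set (ℕ → M)) :
    TSat M I A φ X ↔ ∀ s ∈ X, FSat M I s φ := by
  induction φ generalizing X with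
  | rel r v => rfl
  | nrel r v => rfl
  | eq x y => rfl
  | neq x y => rfl
  | dep i v => exact i.elim
  | gdisj _ _ => exact (hφ.2 : False).elim
  | cneg _ => exact (hφ.1 : False).elim
  | and α β h1 h2 =>
    have h := plain_and.1 hφ
    simp only [TSat, FSat, h1 h.1, h2 h.2]
    exact ⟨fun h s hs => ⟨h.1 s hs, h.2 s hs⟩,
      fun h => ⟨fun s hs => (h s hs).1, fun s hs => (h s hs).2⟩⟩
  | or α β h1 h2 =>
    have h := plain_or.1 hφ
    simp only [TSat, FSat, h1 h.1, h2 h.2]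
    constructor
    · rintro ⟨Y, Z, rfl, hY, hZ⟩ s (hs | hs)
      exacts [.inl (hY s hs), .inr (hZ s hs)]
    · intro h
      refine ⟨{s ∈ X | FSat M I s α}, {s ∈ X | FSat M I s β}, ?_,
        fun s hs => hs.2, fun s hs => hs.2⟩
      ext s
      constructor
      · rintro (hs | hs)
        exacts [hs.1, hs.1]
      · intro hs
        exact (h s hs).imp (fun h => ⟨hs, h⟩) fun h => ⟨hs, h⟩
  | ex v α h1 =>
    simp only [TSat, FSat, h1 (plain_ex.1 hφ)]
    constructor
    · rintro ⟨H, hH, h⟩ s hs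
      obtain ⟨m, hm⟩ := hH s hs
      exact ⟨m, h _ ⟨s, hs, m, hm, rfl⟩⟩
    · intro h
      refine ⟨fun s => {m | FSat M I (Function.update s v m) α}, h, ?_⟩
      rintro _ ⟨s, hs, m, hm, rfl⟩
      exact hm
  | al v α h1 =>
    simp only [TSat, FSat, h1 (plain_al.1 hφ)]
    constructor
    · exact fun h s hs m => h _ ⟨s, hs, m, rfl⟩
    · rintro h _ ⟨s, hs, m, rfl⟩
      exact h s hs m

/-- First-order formulas as formulas of a team logic. -/
def emb : FOF S → TS S ι ar := bindDep fun i => i.elim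

theorem plain_emb {φ : FOF S} (hφ : Plain φ) : Plain (emb φ : TS S ι ar) :=
  plain_bindDep (fun i => i.elim) hφ

theorem tsat_emb {φ : FOF S} (hφ : Plain φ) {A : ∀ i, Set (Fin (ar i) → M) → Prop}
    (X : Set (ℕ → M)) : TSat M I A (emb φ) X ↔ ∀ s ∈ X, FSat M I s φ :=
  (tsat_bindDep (A := fun i => i.elim) _ (fun i => i.elim) φ X).trans (tsat_iff_forall_fsat hφ X)

/-- Equality of two tuples of variables. -/
def eqT (v w : Fin k → ℕ) : FOF S :=
  (List.finRange k).foldr (fun j φ => .and (.eq (v j) (w j)) φ) (.eq 0 0)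

/-- Difference of two tuples of variables. -/
def neqT (v w : Fin k → ℕ) : FOF S :=
  (List.finRange k).foldr (fun j φ => .or (.neq (v j) (w j)) φ) (.neq 0 0)

theorem plain_eqT (v w : Fin k → ℕ) : Plain (eqT v w : FOF S) := by
  unfold eqT
  induction List.finRange k with
  | nil => exact ⟨trivial, trivial⟩
  | cons j l ih => exact plain_and.2 ⟨⟨trivial, trivial⟩, ih⟩

theorem plain_neqT (v w : Fin k → ℕ) : Plain (neqT v w : FOF S) := by
  unfold neqT
  induction List.finRange k with
  | nil => exact ⟨trivial, trivial⟩
  | cons j l ih => exact plain_or.2 ⟨⟨trivial, trivial⟩, ih⟩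

theorem fsat_eqT (v w : Fin k → ℕ) (s : ℕ → M) :
    FSat M I s (eqT v w) ↔ ∀ j, s (v j) = s (w j) := by
  have : ∀ l : List (Fin k), FSat M I s
      (l.foldr (fun j φ => .and (.eq (v j) (w j)) φ) (.eq 0 0) : FOF S) ↔
      ∀ j ∈ l, s (v j) = s (w j) := by
    intro l
    induction l with
    | nil => simp [FSat]
    | cons j l ih => simp [FSat, ih]
  simp [eqT, this]

theorem fsat_neqT (v w : Fin k → ℕ) (s : ℕ → M) :
    FSat M I s (neqT v w) ↔ ∃ j, s (v j) ≠ s (w j) := by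
  have : ∀ l : List (Fin k), FSat M I s
      (l.foldr (fun j φ => .or (.neq (v j) (w j)) φ) (.neq 0 0) : FOF S) ↔
      ∃ j ∈ l, s (v j) ≠ s (w j) := by
    intro l
    induction l with
    | nil => simp [FSat]
    | cons j l ih => simp [FSat, ih]
  simp [neqT, this]

theorem teamProj_mono {v : Fin k → ℕ} {X Y : Set (ℕ → M)} (h : X ⊆ Y) :
    teamProj v X ⊆ teamProj v Y := by
  rintro _ ⟨s, hs, rfl⟩
  exact ⟨s, h hs, rfl⟩

theorem teamProj_empty (v : Fin k → ℕ) : teamProj v (∅ : Set (ℕ → M)) = ∅ := by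
  ext; simp [teamProj]

/-- The consecutive variables starting at `B`. -/
def block (k B : ℕ) : Fin k → ℕ := fun j => B + j

/-- The list of consecutive variables starting at `B`. -/
def blockList (k B : ℕ) : List ℕ := List.ofFn (block k B)

theorem mem_blockList {B x : ℕ} : x ∈ blockList k B ↔ ∃ j : Fin k, B + j = x := by
  simp [blockList, block, List.mem_ofFn]

/-- Overwrite the values of the variables `B, …, B + k - 1`. -/
def setBlock (B : ℕ) (t : Fin k → M) (s : ℕ → M) : ℕ → M := fun x =>
  if h : B ≤ x ∧ x - B < k then t ⟨x - B, h.2⟩ else s x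

theorem setBlock_block (B : ℕ) (t : Fin k → M) (s : ℕ → M) (j : Fin k) :
    setBlock B t s (block k B j) = t j := by
  have : B ≤ B + (j : ℕ) ∧ B + (j : ℕ) - B < k := ⟨by omega, by omega⟩
  simp only [setBlock, block, this]
  simp

theorem setBlock_agree (B : ℕ) (t : Fin k → M) (s : ℕ → M) :
    AgreeOff (blockList k B) s (setBlock B t s) := by
  intro x hx
  have : ¬ (B ≤ x ∧ x - B < k) := by
    rintro ⟨h1, h2⟩
    exact hx (mem_blockList.2 ⟨⟨x - B, h2⟩, by simp; omega⟩)
  simp only [setBlock, this, dif_neg, not_false_eq_true]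

theorem exists_bound (w : Fin k → ℕ) : ∃ B, ∀ j, w j < B := by
  obtain ⟨B, hB⟩ := (Set.finite_range w).bddAbove
  exact ⟨B + 1, fun j => Nat.lt_succ_of_le (hB ⟨j, rfl⟩)⟩

end Flat

section Hierarchy

variable {k : ℕ} {D : DepPred k}

/-- The dependency from `{D, ∼D}` used at level `j` of the difference hierarchy. -/
def parity (j : ℕ) : Bool := j % 2 == 0

/-- The difference hierarchy of `D`: there is an alternating increasing chain of length `j`
above `R`. -/
def diffH (D : DepPred k) : ℕ → DepPred k
  | 0 => fun _ _ => True
  | j + 1 => fun M R => ∃ Z, R ⊆ Z ∧ pairFam D (parity j) M Z ∧ diffH D j M Z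

theorem diffH_anti {M : Type} {R R' : Set (Fin k → M)} {j : ℕ} (h : R ⊆ R')
    (h' : diffH D j M R') : diffH D j M R := by
  cases j with
  | zero => trivial
  | succ j =>
    obtain ⟨Z, hZ, h'⟩ := h'
    exact ⟨Z, h.trans hZ, h'⟩

theorem exists_chain_of_diffH {M : Type} {N : ℕ} {R : Set (Fin k → M)} (h : diffH D N M R) :
    ∃ Z : ℕ → Set (Fin k → M), Monotone Z ∧ R ⊆ Z 0 ∧
      ∀ i < N, pairFam D (parity (N - 1 - i)) M (Z i) := by
  induction N generalizing R with
  | zero => exact ⟨fun _ => R, monotone_const, subset_rfl,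
      fun i hi => absurd hi (Nat.not_lt_zero i)⟩
  | succ N ih =>
    obtain ⟨Z0, hR, hl, h⟩ := h
    obtain ⟨Z, hm, h0, hZ⟩ := ih h
    refine ⟨fun i => i.casesOn Z0 Z, monotone_nat_of_le_succ ?_, hR, ?_⟩
    · rintro (_ | i)
      exacts [h0, hm (Nat.le_succ i)]
    · rintro (_ | i) hi
      · exact hl
      · have := hZ i (by omega)
        rwa [show N + 1 - 1 - (i + 1) = N - 1 - i by omega]

theorem pairFam_not (b : Bool) (M : Type) (R : Set (Fin k → M)) :
    pairFam D (!b) M R ↔ ¬ pairFam D b M R := by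
  cases b <;> simp [pairFam, complD]

theorem exists_diffH_empty (h : SFOFam (ar := fun _ => k) (pairFam D)) :
    ∃ N, ∀ M : Type, Nontrivial M → ∀ R, ¬ diffH D N M R := by
  obtain ⟨n, hn⟩ := exists_chain_bound h
  refine ⟨2 * n + 2, fun M hM R hR => hn M hM ?_⟩
  obtain ⟨Z, hm, -, hZ⟩ := exists_chain_of_diffH hR
  refine ⟨Z, hm, fun j hj => ⟨?_, ?_⟩⟩
  · have := hZ (2 * j) (by omega)
    rwa [show parity (2 * n + 2 - 1 - 2 * j) = false by simp [parity]; omega] at this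
  · have := hZ (2 * j + 1) (by omega)
    rwa [show parity (2 * n + 2 - 1 - (2 * j + 1)) = true by simp [parity]; omega] at this

theorem pairFam_iff_diffH {M : Type} {N : ℕ} (hN : ∀ R, ¬ diffH D N M R) (b : Bool)
    (R : Set (Fin k → M)) :
    pairFam D b M R ↔ ∃ j < N, parity j = (!b) ∧ diffH D j M R ∧ ¬ diffH D (j + 1) M R := by
  constructor
  · intro h
    have : ∃ j < N, diffH D j M R ∧ ¬ diffH D (j + 1) M R := by
      by_contra hc
      push Not at hc
      have : ∀ j ≤ N, diffH D j M R := by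
        intro j
        induction j with
        | zero => exact fun _ => trivial
        | succ j ih => exact fun hj => hc j hj (ih (by omega))
      exact hN R (this N le_rfl)
    obtain ⟨j, hj, h1, h2⟩ := this
    refine ⟨j, hj, ?_, h1, h2⟩
    by_contra hb
    have : parity j = b := by revert hb; cases parity j <;> cases b <;> simp
    exact h2 ⟨R, subset_rfl, this ▸ h, h1⟩
  · rintro ⟨j, -, hb, h1, h2⟩
    by_contra h
    rw [← pairFam_not, ← hb] at h
    exact h2 ⟨R, subset_rfl, h, h1⟩

/-- A downwards closed dependency that is expressible in `FO(D, ∼D)` on nonempty teams, and for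
which the satisfaction by the empty team is first-order definable. -/
structure Good (D P : DepPred k) : Prop where
  down : ∀ (M : Type) (R R' : Set (Fin k → M)), R ⊆ R' → P M R' → P M R
  empty : ∀ S : Signature, FODef (S := S) fun M _ => P M ∅
  term : ∀ (S : Signature) (w : Fin k → ℕ), ∃ Θ : TS S Bool (fun _ => k), Plain Θ ∧
    ∀ M : Type, Nontrivial M → ∀ (I : Interp S M) (X : Set (ℕ → M)), X.Nonempty →
      (TSat M I (fun b => pairFam D b M) Θ X ↔ P M (teamProj w X))

theorem foDef_pairFam_empty (h : SFOFam (ar := fun _ => k) (pairFam D)) (b : Bool)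
    (S : Signature) : FODef (S := S) fun M _ => pairFam D b M ∅ := by
  refine (sfoFam_iff.1 h S
    (.or (.eq 0 0) (.and (.neq 0 0) (.dep b (block k 0)))) ?_).congr fun M _ I => ?_
  · simp [Plain, NoCneg, NoGdisj]
  · simp only [TTrue, TSat]
    constructor
    · rintro ⟨Y, Z, -, -, h1, h2⟩
      rw [Set.eq_empty_of_forall_notMem fun s hs => h1 s hs rfl, teamProj_empty] at h2
      exact h2
    · intro h
      refine ⟨Set.univ, ∅, by simp, fun _ _ => trivial, fun _ h => h.elim, ?_⟩
      rwa [teamProj_empty]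

theorem Good.top : Good D (diffH D 0) where
  down _ _ _ _ _ := trivial
  empty S := FODef.true
  term S w := ⟨.eq 0 0, ⟨trivial, trivial⟩, fun M _ I X _ => by simp [TSat, diffH]⟩

theorem Good.empty_step (h : SFOFam (ar := fun _ => k) (pairFam D)) {P : DepPred k}
    (hP : Good D P) (b : Bool) (S : Signature) :
    FODef (S := S) fun M _ => ∃ Z, pairFam D b M Z ∧ P M Z := by
  obtain ⟨Θ, hΘ, hs⟩ := hP.term S (block k 0)
  have h1 := sfoFam_iff.1 h S (exs (blockList k 0) (.and (.dep b (block k 0)) Θ))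
    (plain_exs.2 (plain_and.2 ⟨⟨trivial, trivial⟩, hΘ⟩))
  refine (h1.or ((foDef_pairFam_empty h b S).and (hP.empty S))).congr fun M hM I => ?_
  unfold TTrue
  rw [tsat_exs]
  constructor
  · rintro (⟨X, hX, h1, h2⟩ | ⟨h1, h2⟩)
    · exact ⟨_, h1, (hs M hM I X (hX.nonempty Set.univ_nonempty)).1 h2⟩
    · exact ⟨_, h1, h2⟩
  · rintro ⟨Z, h1, h2⟩
    obtain rfl | ⟨t, ht⟩ := Z.eq_empty_or_nonempty
    · exact .inr ⟨h1, h2⟩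
    left
    have hZ : teamProj (block k 0) {s : ℕ → M | (fun j => s (block k 0 j)) ∈ Z} = Z := by
      ext t
      constructor
      · rintro ⟨s, hs, rfl⟩
        exact hs
      · intro ht
        obtain ⟨m, -⟩ := exists_pair_ne M
        have e : (fun j => setBlock 0 t (fun _ => m) (block k 0 j)) = t :=
          funext fun j => setBlock_block 0 t _ j
        exact ⟨setBlock 0 t fun _ => m, by rwa [Set.mem_ofPred_eq, e], e.symm⟩
    have hX : Ext (blockList k 0) (Set.univ : Set (ℕ → M))
        {s : ℕ → M | (fun j => s (block k 0 j)) ∈ Z} := by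
      refine ⟨fun s _ => ⟨s, trivial, .refl s⟩,
        fun s _ => ⟨setBlock 0 t s, ?_, setBlock_agree 0 t s⟩⟩
      have e : (fun j => setBlock 0 t s (block k 0 j)) = t :=
        funext fun j => setBlock_block 0 t _ j
      rwa [Set.mem_ofPred_eq, e]
    refine ⟨_, hX, ?_, (hs M hM I _ (hX.nonempty Set.univ_nonempty)).2 ?_⟩
    · change pairFam D b M (teamProj _ _)
      rwa [hZ]
    · rwa [hZ]

theorem Good.step (h : SFOFam (ar := fun _ => k) (pairFam D)) {P : DepPred k}
    (hP : Good D P) (b : Bool) :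
    Good D fun M R => ∃ Z, R ⊆ Z ∧ pairFam D b M Z ∧ P M Z where
  down := by
    rintro M R R' hR ⟨Z, hZ, h⟩
    exact ⟨Z, hR.trans hZ, h⟩
  empty S := (hP.empty_step h b S).congr fun M _ I => by simp
  term S w := by
    obtain ⟨B, hB⟩ := exists_bound w
    obtain ⟨Θ, hΘ, hs⟩ := hP.term S (block k B)
    refine ⟨als (blockList k B) (.or (emb (neqT (block k B) w)) (.and (.dep b (block k B)) Θ)),
      plain_als.2 (plain_or.2 ⟨plain_emb (plain_neqT _ _),
        plain_and.2 ⟨⟨trivial, trivial⟩, hΘ⟩⟩), fun M hM I X hX => ?_⟩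
    have hw : ∀ {s s' : ℕ → M}, AgreeOff (blockList k B) s s' →
        (fun j => s' (w j)) = fun j => s (w j) := by
      intro s s' e
      refine funext fun j => e _ fun hj => ?_
      obtain ⟨i, hi⟩ := mem_blockList.1 hj
      have := hB j
      omega
    have e : ∀ (t : Fin k → M) s, (fun j => setBlock B t s (block k B j)) = t :=
      fun t s => funext fun j => setBlock_block B t _ j
    rw [tsat_als]
    constructor
    · rintro ⟨Y, Z, hYZ, h1, h2, h3⟩
      rw [tsat_emb (plain_neqT _ _)] at h1
      have hmem : ∀ s ∈ X, setBlock B (fun j => s (w j)) s ∈ Z := by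
        intro s hs
        have : setBlock B (fun j => s (w j)) s ∈ Y ∪ Z := by
          rw [hYZ]
          exact ⟨s, hs, setBlock_agree _ _ _⟩
        refine this.resolve_left fun hY => ?_
        obtain ⟨j, hj⟩ := (fsat_neqT _ _ _).1 (h1 _ hY)
        rw [setBlock_block] at hj
        exact hj (congrFun (hw (setBlock_agree B (fun j => s (w j)) s)) j).symm
      obtain ⟨s0, hs0⟩ := hX
      refine ⟨_, ?_, h2, (hs M hM I Z ⟨_, hmem s0 hs0⟩).1 h3⟩
      rintro _ ⟨s, hs, rfl⟩
      exact ⟨_, hmem s hs, (e _ _).symm⟩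
    · rintro ⟨Z, hZ, h1, h2⟩
      obtain ⟨s0, hs0⟩ := hX
      let X' := {s' : ℕ → M | ∃ s ∈ X, AgreeOff (blockList k B) s s'}
      have hp : teamProj (block k B) {s ∈ X' | (fun j => s (block k B j)) ∈ Z} = Z := by
        ext t
        constructor
        · rintro ⟨s, hs, rfl⟩
          exact hs.2
        · intro ht
          exact ⟨setBlock B t s0, ⟨⟨s0, hs0, setBlock_agree B t s0⟩, by rwa [e]⟩, (e _ _).symm⟩
      have hne : ({s ∈ X' | (fun j => s (block k B j)) ∈ Z}).Nonempty :=
        ⟨setBlock B (fun j => s0 (w j)) s0, ⟨s0, hs0, setBlock_agree _ _ _⟩, by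
          rw [e]; exact hZ ⟨s0, hs0, rfl⟩⟩
      refine ⟨{s ∈ X' | (fun j => s (block k B j)) ∉ Z},
        {s ∈ X' | (fun j => s (block k B j)) ∈ Z}, ?_, ?_, ?_, ?_⟩
      · ext s
        by_cases hs : (fun j => s (block k B j)) ∈ Z
        · exact ⟨fun h => h.elim (·.1) (·.1), fun h => .inr ⟨h, hs⟩⟩
        · exact ⟨fun h => h.elim (·.1) (·.1), fun h => .inl ⟨h, hs⟩⟩
      · rw [tsat_emb (plain_neqT _ _)]
        rintro s' ⟨⟨s, hs, ha⟩, hn⟩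
        rw [fsat_neqT]
        by_contra hc
        push Not at hc
        refine hn ?_
        rw [funext hc, hw ha]
        exact hZ ⟨s, hs, rfl⟩
      · change pairFam D b M (teamProj _ _)
        rwa [hp]
      · rw [hs M hM I _ hne, hp]
        exact h2

theorem good_diffH (h : SFOFam (ar := fun _ => k) (pairFam D)) (j : ℕ) : Good D (diffH D j) := by
  induction j with
  | zero => exact Good.top
  | succ j ih => exact ih.step h (parity j)

end Hierarchy

section Substitution

variable {S : Signature} {k : ℕ}

/-- The formula with free variables `u` defining `teamProj v {s | χ(s)}`. -/
noncomputable def projF (χ : FOF S) (v u : Fin k → ℕ) : FOF S :=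
  let N := (exists_bound u).choose
  exs ((fvList χ ++ List.ofFn v).map (· + N))
    (.and (ren (· + N) χ) (eqT (fun j => v j + N) u))

theorem fsat_projF {M : Type} {I : Interp S M} (χ : FOF S) (v u : Fin k → ℕ) (s : ℕ → M) :
    FSat M I s (projF χ v u) ↔ (fun j => s (u j)) ∈ teamProj v {s | FSat M I s χ} := by
  have hN := (exists_bound u).choose_spec
  unfold projF
  set N := (exists_bound u).choose
  have hu : ∀ j, u j ∉ (fvList χ ++ List.ofFn v).map (· + N) := by
    intro j hj
    obtain ⟨x, -, hx⟩ := List.mem_map.1 hj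
    have := hN j
    omega
  simp only [fsat_exs, FSat, fsat_eqT, fsat_ren (add_left_injective N)]
  constructor
  · rintro ⟨s', ha, h1, h2⟩
    refine ⟨_, h1, funext fun j => ?_⟩
    rw [h2 j, ha _ (hu j)]
  · rintro ⟨t, ht, he⟩
    classical
    let s' : ℕ → M := fun x =>
      if x ∈ (fvList χ ++ List.ofFn v).map (· + N) then t (x - N) else s x
    have hs : ∀ x ∈ fvList χ ++ List.ofFn v, s' (x + N) = t x := by
      intro x hx
      have : x + N ∈ (fvList χ ++ List.ofFn v).map (· + N) := List.mem_map.2 ⟨x, hx, rfl⟩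
      simp only [s', this, if_true, Nat.add_sub_cancel]
    refine ⟨s', fun x hx => by simp only [s', hx, if_false], ?_, fun j => ?_⟩
    · refine (fsat_congr χ fun x hx => hs x ?_).2 ht
      simp [fvList, hx]
    · rw [hs _ (by simp)]
      simp only [s', hu j, if_false]
      exact (congrFun he j).symm

theorem RDef.comp {K : ∀ M : Type, Interp S M → Set (Fin k → M) → Prop} (hK : RDef K)
    (χ : FOF S) (v : Fin k → ℕ) :
    FODef fun M I => K M I (teamProj v {s | FSat M I s χ}) := by
  obtain ⟨ψ, hψ⟩ := hK
  let σ : ∀ n, SigAdd S k n → (Fin n → ℕ) → FOF S := fun n r u => match r with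
    | .inl r => .rel r u
    | .inr h => projF χ v fun i => u (Fin.cast h.down.symm i)
  refine ⟨subRel σ ψ, fun M hM I s => ?_⟩
  rw [fsat_subRel (I := addI I (teamProj v {s | FSat M I s χ})) σ ?_ ψ s]
  · exact hψ M hM I _ s
  · rintro n (r | h) u s
    · rfl
    · exact fsat_projF χ v _ s

theorem RDef.empty {K : ∀ M : Type, Interp S M → Set (Fin k → M) → Prop} (hK : RDef K) :
    FODef fun M I => K M I ∅ := by
  refine (hK.comp (.neq 0 0) (block k 0)).congr fun M _ I => ?_
  simp [FSat, teamProj]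

end Substitution

section Game

variable {S : Signature} {k : ℕ} {M : Type} {I : Interp S M}

/-- The universal player's variable in round `l`. -/
def moveX (k l : ℕ) : ℕ := 1 + k + 2 * l

/-- The existential player's variable in round `l`. -/
def moveY (k l : ℕ) : ℕ := 2 + k + 2 * l

/-- The quantifier prefix of a game with `n` rounds, starting with round `l`. -/
def prefixF {ι : Type} {ar : ι → ℕ} (k : ℕ) : ℕ → ℕ → TS S ι ar → TS S ι ar
  | 0, _, β => β
  | n + 1, l, β => .al (moveX k l) (.ex (moveY k l) (prefixF k n (l + 1) β))

/-- The assignment after round `l`. -/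
def move (k l : ℕ) (s : ℕ → M) (m m' : M) : ℕ → M :=
  Function.update (Function.update s (moveX k l) m) (moveY k l) m'

/-- The existential player wins the game with winning condition `P` from `s`. -/
def GameWin (k : ℕ) : ℕ → ℕ → ((ℕ → M) → Prop) → (ℕ → M) → Prop
  | 0, _, P, s => P s
  | n + 1, l, P, s => ∀ m, ∃ m', GameWin k n (l + 1) P (move k l s m m')

section Prefix

variable {ι : Type} {ar : ι → ℕ} {A : ∀ i, Set (Fin (ar i) → M) → Prop}

theorem plain_prefixF {n l : ℕ} {β : TS S ι ar} (h : Plain β) : Plain (prefixF k n l β) := by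
  induction n generalizing l with
  | zero => exact h
  | succ n ih => exact plain_al.2 (plain_ex.2 ih)

theorem gameWin_of_tsat [Nonempty M] {n l : ℕ} {β : TS S ι ar} {X : Set (ℕ → M)}
    (h : TSat M I A (prefixF k n l β) X) : ∃ X', (X.Nonempty → X'.Nonempty) ∧
      TSat M I A β X' ∧ ∀ P : (ℕ → M) → Prop, (∀ s ∈ X', P s) → ∀ s ∈ X, GameWin k n l P s := by
  induction n generalizing l X with
  | zero => exact ⟨X, id, h, fun P hP => hP⟩
  | succ n ih =>
    obtain ⟨H, hH, h⟩ := h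
    obtain ⟨X', h1, h2, h3⟩ := ih h
    refine ⟨X', ?_, h2, fun P hP s hs m => ?_⟩
    · rintro ⟨s, hs⟩
      obtain ⟨m'⟩ := ‹Nonempty M›
      obtain ⟨m, hm⟩ := hH _ ⟨s, hs, m', rfl⟩
      exact h1 ⟨_, _, ⟨s, hs, m', rfl⟩, m, hm, rfl⟩
    · obtain ⟨m', hm'⟩ := hH _ ⟨s, hs, m, rfl⟩
      exact ⟨m', h3 P hP _ ⟨_, ⟨s, hs, m, rfl⟩, m', hm', rfl⟩⟩

theorem tsat_of_gameWin [Nonempty M] {n l : ℕ} {β : TS S ι ar} {P : (ℕ → M) → Prop}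
    (hβ : ∀ X : Set (ℕ → M), X.Nonempty → (∀ s ∈ X, P s) → TSat M I A β X)
    {X : Set (ℕ → M)} (hX : X.Nonempty) (h : ∀ s ∈ X, GameWin k n l P s) :
    TSat M I A (prefixF k n l β) X := by
  induction n generalizing l X with
  | zero => exact hβ X hX h
  | succ n ih =>
    refine ⟨fun s => {m' | GameWin k n (l + 1) P (Function.update s (moveY k l) m')}, ?_, ?_⟩
    · rintro _ ⟨s, hs, m, rfl⟩
      exact h s hs m
    · refine ih ?_ ?_
      · obtain ⟨s, hs⟩ := hX
        obtain ⟨m⟩ := ‹Nonempty M›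
        obtain ⟨m', hm'⟩ := h s hs m
        exact ⟨_, _, ⟨s, hs, m, rfl⟩, m', hm', rfl⟩
      · rintro _ ⟨_, -, m', hm', rfl⟩
        exact hm'

end Prefix

theorem move_below {l x : ℕ} (h : x < moveX k l) (s : ℕ → M) (m m' : M) :
    move k l s m m' x = s x := by
  unfold move
  rw [Function.update_of_ne (by simp only [moveX, moveY] at *; omega),
    Function.update_of_ne (by omega)]

theorem move_moveX (l : ℕ) (s : ℕ → M) (m m' : M) : move k l s m m' (moveX k l) = m := by
  unfold move
  rw [Function.update_of_ne (by simp only [moveX, moveY]; omega), Function.update_self]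

theorem move_moveY (l : ℕ) (s : ℕ → M) (m m' : M) : move k l s m m' (moveY k l) = m' :=
  Function.update_self ..

theorem moveX_succ (l : ℕ) : moveX k (l + 1) = moveX k l + 2 := by
  simp only [moveX]; omega

theorem gameWin_congr {n l : ℕ} {P P' : (ℕ → M) → Prop} {s : ℕ → M}
    (h : ∀ s', (∀ x < moveX k l, s' x = s x) → (P s' ↔ P' s')) :
    GameWin k n l P s ↔ GameWin k n l P' s := by
  induction n generalizing l s with
  | zero => exact h s fun _ _ => rfl
  | succ n ih =>
    refine forall_congr' fun m => exists_congr fun m' => ih fun s' hs' => h s' fun x hx => ?_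
    rw [hs' x (by rw [moveX_succ]; omega), move_below hx]

theorem gameWin_const [Nonempty M] {n l : ℕ} {Q : Prop} {s : ℕ → M} :
    GameWin k n l (fun _ => Q) s ↔ Q := by
  induction n generalizing l s with
  | zero => rfl
  | succ n ih => simp only [GameWin, ih, forall_const, exists_const]

/-- Quantifier and connective depth. -/
def depth : Pos S k → ℕ
  | .base _ => 0
  | .R _ => 0
  | .and p q => max (depth p) (depth q) + 1
  | .or p q => max (depth p) (depth q) + 1
  | .ex _ p => depth p + 1
  | .al _ p => depth p + 1

/-- A literal with renamed variables as a formula. -/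
def litF (ρ : ℕ → ℕ) : Lit S → FOF S
  | .rel r v => .rel r fun i => ρ (v i)
  | .nrel r v => .nrel r fun i => ρ (v i)
  | .eq x y => .eq (ρ x) (ρ y)
  | .neq x y => .neq (ρ x) (ρ y)

theorem plain_litF (ρ : ℕ → ℕ) (a : Lit S) : Plain (litF ρ a) := by
  cases a <;> exact ⟨trivial, trivial⟩

theorem fsat_litF (ρ : ℕ → ℕ) (a : Lit S) (s : ℕ → M) :
    FSat M I s (litF ρ a) ↔ LSat M I (fun x => s (ρ x)) a := by
  cases a <;> rfl

/-- The variables holding the tuple that is queried at the end of the game. -/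
def endTuple (k : ℕ) : Fin k → ℕ := block k 1

/-- The winning condition of the evaluation game of `p`. -/
def winF : Pos S k → (ℕ → ℕ) → ℕ → FOF S
  | .base a, ρ, _ => litF ρ a
  | .R v, ρ, _ => eqT (endTuple k) fun i => ρ (v i)
  | .and p q, ρ, l => .or (.and (.eq (moveX k l) 0) (winF p ρ (l + 1)))
      (.and (.neq (moveX k l) 0) (winF q ρ (l + 1)))
  | .or p q, ρ, l => .or (.and (.eq (moveY k l) 0) (winF p ρ (l + 1)))
      (.and (.neq (moveY k l) 0) (winF q ρ (l + 1)))
  | .ex v p, ρ, l => winF p (Function.update ρ v (moveY k l)) (l + 1)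
  | .al v p, ρ, l => winF p (Function.update ρ v (moveX k l)) (l + 1)

theorem plain_winF (p : Pos S k) (ρ : ℕ → ℕ) (l : ℕ) : Plain (winF p ρ l) := by
  have a : ∀ x y, Plain (.eq x y : FOF S) := fun _ _ => ⟨trivial, trivial⟩
  have b : ∀ x y, Plain (.neq x y : FOF S) := fun _ _ => ⟨trivial, trivial⟩
  induction p generalizing ρ l with
  | base c => exact plain_litF ρ c
  | R v => exact plain_eqT _ _
  | and p q h1 h2 => exact plain_or.2 ⟨plain_and.2 ⟨a _ _, h1 _ _⟩, plain_and.2 ⟨b _ _, h2 _ _⟩⟩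
  | or p q h1 h2 => exact plain_or.2 ⟨plain_and.2 ⟨a _ _, h1 _ _⟩, plain_and.2 ⟨b _ _, h2 _ _⟩⟩
  | ex v p h => exact h _ _
  | al v p h => exact h _ _

/-- The query tuple can be chosen in `Z` such that the winning condition holds. -/
def Wins (I : Interp S M) (Z : Set (Fin k → M)) (φ : FOF S) (s : ℕ → M) : Prop :=
  ∃ s', AgreeOff (blockList k 1) s s' ∧ (fun j => s' (endTuple k j)) ∈ Z ∧ FSat M I s' φ

theorem wins_or_iff {Z : Set (Fin k → M)} {φ ψ : FOF S} {x : ℕ}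
    (hx : x ∉ blockList k 1) (s : ℕ → M) :
    Wins I Z (.or (.and (.eq x 0) φ) (.and (.neq x 0) ψ)) s ↔
      (s x = s 0 ∧ Wins I Z φ s) ∨ (s x ≠ s 0 ∧ Wins I Z ψ s) := by
  have h0 : 0 ∉ blockList k 1 := fun h => by
    obtain ⟨j, hj⟩ := mem_blockList.1 h
    omega
  constructor
  · rintro ⟨s', ha, hz, ⟨h, hs⟩ | ⟨h, hs⟩⟩ <;>
      simp only [FSat, ha x hx, ha 0 h0] at h
    exacts [.inl ⟨h, s', ha, hz, hs⟩, .inr ⟨h, s', ha, hz, hs⟩]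
  · rintro (⟨h, s', ha, hz, hs⟩ | ⟨h, s', ha, hz, hs⟩)
    · exact ⟨s', ha, hz, .inl ⟨by simpa only [FSat, ha x hx, ha 0 h0] using h, hs⟩⟩
    · exact ⟨s', ha, hz, .inr ⟨by simpa only [FSat, ha x hx, ha 0 h0] using h, hs⟩⟩

theorem setBlock_endTuple (t : Fin k → M) (s : ℕ → M) :
    (fun j => setBlock 1 t s (endTuple k j)) = t :=
  funext fun j => setBlock_block 1 t s j

theorem move_notMem {x l : ℕ} (h : moveX k l ≤ x) : x ∉ blockList k 1 := fun hx => by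
  obtain ⟨j, hj⟩ := mem_blockList.1 hx
  simp only [moveX] at h
  omega

theorem gameWin_iff_psat [Nontrivial M] {Z : Set (Fin k → M)} (p : Pos S k) {n l : ℕ}
    {ρ : ℕ → ℕ} (hρ : ∀ x, ρ x < moveX k l ∧ ρ x ∉ blockList k 1) (hn : depth p ≤ n)
    (hZ : Z.Nonempty) {s : ℕ → M} :
    GameWin k n l (Wins I Z (winF p ρ l)) s ↔ PSat M I Z (fun x => s (ρ x)) p := by
  induction p generalizing n l ρ s with
  | base a =>
    rw [gameWin_congr (P' := fun _ => LSat M I (fun x => s (ρ x)) a), gameWin_const]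
    · rfl
    intro s' hs'
    have e : ∀ {t}, AgreeOff (blockList k 1) s' t →
        (fun x => t (ρ x)) = fun x => s (ρ x) := fun ht =>
      funext fun x => (ht _ (hρ x).2).trans (hs' _ (hρ x).1)
    constructor
    · rintro ⟨t, ht, -, h⟩
      rwa [winF, fsat_litF, e ht] at h
    · intro h
      obtain ⟨z, hz⟩ := hZ
      refine ⟨setBlock 1 z s', setBlock_agree _ _ _, by rwa [setBlock_endTuple], ?_⟩
      rwa [winF, fsat_litF, e (setBlock_agree _ _ _)]
  | R v =>
    rw [gameWin_congr (P' := fun _ => (fun i => s (ρ (v i))) ∈ Z), gameWin_const]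
    · rfl
    intro s' hs'
    have e : ∀ {t}, AgreeOff (blockList k 1) s' t → ∀ x, t (ρ x) = s (ρ x) := fun ht x =>
      (ht _ (hρ x).2).trans (hs' _ (hρ x).1)
    constructor
    · rintro ⟨t, ht, hz, h⟩
      have h := funext ((fsat_eqT _ _ _).1 h)
      rw [h] at hz
      simpa only [e ht] using hz
    · intro h
      refine ⟨setBlock 1 (fun i => s (ρ (v i))) s', setBlock_agree _ _ _, ?_, ?_⟩
      · rwa [setBlock_endTuple]
      · rw [winF, fsat_eqT]
        intro j
        rw [e (setBlock_agree _ _ _)]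
        exact setBlock_block _ _ _ j
  | and p q h1 h2 =>
    obtain ⟨n, rfl⟩ : ∃ n', n = n' + 1 := ⟨n - 1, by simp only [depth] at hn; omega⟩
    simp only [depth, Nat.add_le_add_iff_right, max_le_iff] at hn
    have hρ' : ∀ x, ρ x < moveX k (l + 1) ∧ ρ x ∉ blockList k 1 := fun x =>
      ⟨by rw [moveX_succ]; have := (hρ x).1; omega, (hρ x).2⟩
    have hm : ∀ m m', GameWin k n (l + 1) (Wins I Z (winF (.and p q) ρ l)) (move k l s m m') ↔
        (m = s 0 ∧ PSat M I Z (fun x => s (ρ x)) p) ∨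
        (m ≠ s 0 ∧ PSat M I Z (fun x => s (ρ x)) q) := by
      intro m m'
      have e : (fun x => move k l s m m' (ρ x)) = fun x => s (ρ x) :=
        funext fun x => move_below (hρ x).1 ..
      rw [← e, ← h1 hρ' hn.1, ← h2 hρ' hn.2]
      have hw : ∀ s', (∀ x < moveX k (l + 1), s' x = move k l s m m' x) →
          (Wins I Z (winF (.and p q) ρ l) s' ↔
            (m = s 0 ∧ Wins I Z (winF p ρ (l + 1)) s') ∨
            (m ≠ s 0 ∧ Wins I Z (winF q ρ (l + 1)) s')) := by
        intro s' hs'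
        rw [winF, wins_or_iff (move_notMem le_rfl), hs' _ (by rw [moveX_succ]; omega), move_moveX,
          hs' 0 (by simp only [moveX]; omega), move_below (by simp only [moveX]; omega)]
      rw [gameWin_congr hw]
      by_cases h : m = s 0 <;> simp [h]
    simp only [GameWin, hm, exists_const, PSat]
    constructor
    · intro h
      obtain ⟨m, hm⟩ := exists_ne (s 0)
      exact ⟨((h (s 0)).resolve_right fun h => h.1 rfl).2, ((h m).resolve_left fun h => hm h.1).2⟩
    · rintro ⟨hp, hq⟩ m
      by_cases h : m = s 0
      exacts [.inl ⟨h, hp⟩, .inr ⟨h, hq⟩]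
  | or p q h1 h2 =>
    obtain ⟨n, rfl⟩ : ∃ n', n = n' + 1 := ⟨n - 1, by simp only [depth] at hn; omega⟩
    simp only [depth, Nat.add_le_add_iff_right, max_le_iff] at hn
    have hρ' : ∀ x, ρ x < moveX k (l + 1) ∧ ρ x ∉ blockList k 1 := fun x =>
      ⟨by rw [moveX_succ]; have := (hρ x).1; omega, (hρ x).2⟩
    have hm : ∀ m m', GameWin k n (l + 1) (Wins I Z (winF (.or p q) ρ l)) (move k l s m m') ↔
        (m' = s 0 ∧ PSat M I Z (fun x => s (ρ x)) p) ∨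
        (m' ≠ s 0 ∧ PSat M I Z (fun x => s (ρ x)) q) := by
      intro m m'
      have e : (fun x => move k l s m m' (ρ x)) = fun x => s (ρ x) :=
        funext fun x => move_below (hρ x).1 ..
      rw [← e, ← h1 hρ' hn.1, ← h2 hρ' hn.2]
      have hw : ∀ s', (∀ x < moveX k (l + 1), s' x = move k l s m m' x) →
          (Wins I Z (winF (.or p q) ρ l) s' ↔
            (m' = s 0 ∧ Wins I Z (winF p ρ (l + 1)) s') ∨
            (m' ≠ s 0 ∧ Wins I Z (winF q ρ (l + 1)) s')) := by
        intro s' hs'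
        rw [winF, wins_or_iff (move_notMem (l := l) (by simp only [moveX, moveY]; omega)),
          hs' (moveY k l) (by simp only [moveX, moveY]; omega), move_moveY,
          hs' 0 (by simp only [moveX]; omega), move_below (by simp only [moveX]; omega)]
      rw [gameWin_congr hw]
      by_cases h : m' = s 0 <;> simp [h]
    simp only [GameWin, hm, forall_const, PSat]
    constructor
    · rintro ⟨m, ⟨-, h⟩ | ⟨-, h⟩⟩
      exacts [.inl h, .inr h]
    · rintro (h | h)
      · exact ⟨s 0, .inl ⟨rfl, h⟩⟩
      · obtain ⟨m, hm⟩ := exists_ne (s 0)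
        exact ⟨m, .inr ⟨hm, h⟩⟩
  | ex v p h =>
    obtain ⟨n, rfl⟩ : ∃ n', n = n' + 1 := ⟨n - 1, by simp only [depth] at hn; omega⟩
    simp only [depth, Nat.add_le_add_iff_right] at hn
    have hρ' : ∀ x, Function.update ρ v (moveY k l) x < moveX k (l + 1) ∧
        Function.update ρ v (moveY k l) x ∉ blockList k 1 := by
      intro x
      by_cases hx : x = v
      · subst hx
        rw [Function.update_self]
        exact ⟨by simp only [moveX, moveY]; omega,
          move_notMem (l := l) (by simp only [moveX, moveY]; omega)⟩
      · rw [Function.update_of_ne hx]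
        exact ⟨by rw [moveX_succ]; have := (hρ x).1; omega, (hρ x).2⟩
    have hm : ∀ m m', GameWin k n (l + 1) (Wins I Z (winF (.ex v p) ρ l)) (move k l s m m') ↔
        PSat M I Z (Function.update (fun x => s (ρ x)) v m') p := by
      intro m m'
      have e : (fun x => move k l s m m' (Function.update ρ v (moveY k l) x)) =
          Function.update (fun x => s (ρ x)) v m' := by
        funext x
        by_cases hx : x = v
        · subst hx; rw [Function.update_self, Function.update_self, move_moveY]
        · rw [Function.update_of_ne hx, Function.update_of_ne hx, move_below (hρ x).1]
      rw [← e]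
      exact h hρ' hn
    simp only [GameWin, hm, forall_const, PSat]
  | al v p h =>
    obtain ⟨n, rfl⟩ : ∃ n', n = n' + 1 := ⟨n - 1, by simp only [depth] at hn; omega⟩
    simp only [depth, Nat.add_le_add_iff_right] at hn
    have hρ' : ∀ x, Function.update ρ v (moveX k l) x < moveX k (l + 1) ∧
        Function.update ρ v (moveX k l) x ∉ blockList k 1 := by
      intro x
      by_cases hx : x = v
      · subst hx
        rw [Function.update_self]
        exact ⟨by rw [moveX_succ]; omega, move_notMem le_rfl⟩
      · rw [Function.update_of_ne hx]
        exact ⟨by rw [moveX_succ]; have := (hρ x).1; omega, (hρ x).2⟩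
    have hm : ∀ m m', GameWin k n (l + 1) (Wins I Z (winF (.al v p) ρ l)) (move k l s m m') ↔
        PSat M I Z (Function.update (fun x => s (ρ x)) v m) p := by
      intro m m'
      have e : (fun x => move k l s m m' (Function.update ρ v (moveX k l) x)) =
          Function.update (fun x => s (ρ x)) v m := by
        funext x
        by_cases hx : x = v
        · subst hx; rw [Function.update_self, Function.update_self, move_moveX]
        · rw [Function.update_of_ne hx, Function.update_of_ne hx, move_below (hρ x).1]
      rw [← e]
      exact h hρ' hn
    simp only [GameWin, hm, exists_const, PSat]

end Game

section Projection

variable {S : Signature} {k : ℕ} {D P : DepPred k}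

/-- Projecting a definable monotone class along a good dependency gives a definable class. -/
theorem Good.exists_foDef (h : SFOFam (ar := fun _ => k) (pairFam D)) (hP : Good D P)
    {K : ∀ M : Type, Interp S M → Set (Fin k → M) → Prop} (hd : RDef K) (hK : MonoR K) :
    FODef fun M I => ∃ R, P M R ∧ K M I R := by
  obtain ⟨p, hp⟩ := exists_pos_of_monoR hd hK
  obtain ⟨Θ, hΘ, hs⟩ := hP.term S (endTuple k)
  let β : TS S Bool (fun _ => k) := exs (blockList k 1) (.and (emb (winF p (fun _ => 0) 0)) Θ)
  have hβ : Plain (prefixF k (depth p) 0 β) :=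
    plain_prefixF (plain_exs.2 (plain_and.2 ⟨plain_emb (plain_winF _ _ _), hΘ⟩))
  have hρ : ∀ x : ℕ, (fun _ : ℕ => 0) x < moveX k 0 ∧ (fun _ : ℕ => 0) x ∉ blockList k 1 := by
    refine fun x => ⟨by simp only [moveX]; omega, fun h => ?_⟩
    obtain ⟨j, hj⟩ := mem_blockList.1 h
    exact absurd hj (by simp only; omega)
  refine ((sfoFam_iff.1 h S _ hβ).or (FODef.and (hP.empty S) hd.empty)).congr fun M hM I => ?_
  have hne : Nonempty M := hM.to_nonempty
  constructor
  · rintro (h1 | h1)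
    · obtain ⟨X, hX, h2, hw⟩ := gameWin_of_tsat h1
      obtain ⟨X', hX', h3, h4⟩ := (tsat_exs _ _ _).1 h2
      rw [tsat_emb (plain_winF _ _ _)] at h3
      have hne' := hX'.nonempty (hX Set.univ_nonempty)
      refine ⟨_, (hs M hM I X' hne').1 h4, ?_⟩
      have s0 : ℕ → M := fun _ => hne.some
      refine (hp M hM I _ _).2 ((gameWin_iff_psat p hρ le_rfl ?_ (s := s0)).1
        (hw (Wins I (teamProj (endTuple k) X') (winF p (fun _ => 0) 0)) ?_ s0 trivial))
      · obtain ⟨s, hs⟩ := hne'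
        exact ⟨_, s, hs, rfl⟩
      · intro s hs
        obtain ⟨s', hs', ha⟩ := hX'.2 s hs
        exact ⟨s', ha, ⟨s', hs', rfl⟩, h3 s' hs'⟩
    · exact ⟨∅, h1⟩
  · rintro ⟨Z, hZ, hk⟩
    obtain rfl | hZne := Z.eq_empty_or_nonempty
    · exact .inr ⟨hZ, hk⟩
    left
    refine tsat_of_gameWin (P := Wins I Z (winF p (fun _ => 0) 0)) ?_ Set.univ_nonempty
      fun s _ => (gameWin_iff_psat p hρ le_rfl hZne).2 ((hp M hM I Z _).1 hk)
    · intro X hX hW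
      let X' := {s' | (∃ s ∈ X, AgreeOff (blockList k 1) s s') ∧
        (fun j => s' (endTuple k j)) ∈ Z ∧ FSat M I s' (winF p (fun _ => 0) 0)}
      have hE : Ext (blockList k 1) X X' := by
        refine ⟨fun s' hs' => hs'.1, fun s hs => ?_⟩
        obtain ⟨s', ha, h⟩ := hW s hs
        exact ⟨s', ⟨⟨s, hs, ha⟩, h⟩, ha⟩
      refine (tsat_exs _ _ _).2 ⟨X', hE, ?_, ?_⟩
      · exact (tsat_emb (plain_winF _ _ _) _).2 fun s hs => hs.2.2
      · refine (hs M hM I X' (hE.nonempty hX)).2 (hP.down M _ Z ?_ hZ)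
        rintro _ ⟨s, hs, rfl⟩
        exact hs.2.1

end Projection

section Elimination

theorem Good.rDef {k : ℕ} {D P : DepPred k} (h : SFOFam (ar := fun _ => k) (pairFam D))
    (hP : Good D P) (S : Signature) : RDef (S := S) fun M _ R => P M R := by
  let K : ∀ M : Type, Interp (SigAdd S k) M → Set (Fin k → M) → Prop := fun M I R =>
    I k (newSym S k) ⊆ R
  have hd : RDef K := by
    refine ⟨als (blockList k 0) (.or (.nrel (.inl (newSym S k)) (block k 0))
      (.rel (newSym (SigAdd S k) k) (block k 0))), fun M hM I R s => ?_⟩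
    rw [fsat_als]
    constructor
    · exact fun h s' _ => (em _).symm.imp id fun hs => h hs
    · intro h t ht
      have e : (fun j => setBlock 0 t s (block k 0 j)) = t := funext fun j => setBlock_block 0 t s j
      have := (h _ (setBlock_agree 0 t s)).resolve_left
        (not_not.2 (show (fun j => setBlock 0 t s (block k 0 j)) ∈ I k (newSym S k) by rwa [e]))
      have : (fun j => setBlock 0 t s (block k 0 j)) ∈ R := this
      rwa [e] at this
  obtain ⟨ψ, hψ⟩ := hP.exists_foDef h hd fun M _ I R R' hR hK => hK.trans hR
  refine ⟨ψ, fun M hM I R s => Iff.trans ?_ (hψ M hM (addI I R) s)⟩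
  exact ⟨fun h => ⟨R, h, subset_rfl⟩, fun ⟨R', h, hR⟩ => hP.down M R R' hR h⟩

variable {S : Signature} {κ : Type} {ar : κ → ℕ}

/-- The first-order part of a formula: dependency atoms are replaced by a tautology. -/
def flat (φ : TS S κ ar) : FOF S := bindDep (fun _ _ => .eq 0 0) φ

theorem fsat_flat {M : Type} {I : Interp S M} (φ : TS S κ ar) (s : ℕ → M) :
    FSat M I s (flat φ) ↔ FSat M I s φ := by
  unfold flat
  induction φ generalizing s <;> simp_all only [FSat, bindDep]

theorem fsat_of_tsat {M : Type} {I : Interp S M} {A : ∀ i, Set (Fin (ar i) → M) → Prop}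
    {φ : TS S κ ar} (hφ : Plain φ) {X : Set (ℕ → M)} (h : TSat M I A φ X) :
    ∀ s ∈ X, FSat M I s φ := by
  induction φ generalizing X with
  | rel r v => exact h
  | nrel r v => exact h
  | eq x y => exact h
  | neq x y => exact h
  | dep i v => exact fun _ _ => trivial
  | gdisj _ _ => exact (hφ.2 : False).elim
  | cneg _ => exact (hφ.1 : False).elim
  | and α β h1 h2 =>
    have hp := plain_and.1 hφ
    exact fun s hs => ⟨h1 hp.1 h.1 s hs, h2 hp.2 h.2 s hs⟩
  | or α β h1 h2 =>
    have hp := plain_or.1 hφ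
    obtain ⟨Y, Z, rfl, hY, hZ⟩ := h
    rintro s (hs | hs)
    exacts [.inl (h1 hp.1 hY s hs), .inr (h2 hp.2 hZ s hs)]
  | ex v α h1 =>
    obtain ⟨H, hH, h⟩ := h
    intro s hs
    obtain ⟨m, hm⟩ := hH s hs
    exact ⟨m, h1 (plain_ex.1 hφ) h _ ⟨s, hs, m, hm, rfl⟩⟩
  | al v α h1 => exact fun s hs m => h1 (plain_al.1 hφ) h _ ⟨s, hs, m, rfl⟩

open Classical in
/-- The number of occurrences of dependency atoms outside `up`. -/
noncomputable def occ (up : κ → Prop) : TS S κ ar → ℕ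
  | .dep i _ => if up i then 0 else 1
  | .and φ ψ => occ up φ + occ up ψ
  | .or φ ψ => occ up φ + occ up ψ
  | .gdisj φ ψ => occ up φ + occ up ψ
  | .cneg φ => occ up φ
  | .ex _ φ => occ up φ
  | .al _ φ => occ up φ
  | _ => 0

theorem occ_mapSig {up : κ → Prop} {S' : Signature} (f : ∀ n, S n → S' n) (φ : TS S κ ar) :
    occ up (mapSig f φ) = occ up φ := by
  induction φ <;> simp_all only [mapSig, occ]

variable {Y : ∀ i, DepPred (ar i)} {up : κ → Prop}

theorem tsat_mono_of_occ_eq_zero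
    (hup : ∀ i, up i → ∀ M R R', R ⊆ R' → Y i M R → Y i M R') {M : Type} {I : Interp S M}
    {φ : TS S κ ar} (hφ : Plain φ) (ho : occ up φ = 0) {X X' : Set (ℕ → M)} (hX : X ⊆ X')
    (h : TSat M I (fun i => Y i M) φ X) (hf : ∀ s ∈ X', FSat M I s φ) :
    TSat M I (fun i => Y i M) φ X' := by
  induction φ generalizing X X' with
  | rel r v => exact hf
  | nrel r v => exact hf
  | eq x y => exact hf
  | neq x y => exact hf
  | dep i v =>
    have : up i := by
      by_contra hc
      simp [occ, hc] at ho
    exact hup i this M _ _ (teamProj_mono hX) h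
  | gdisj _ _ => exact (hφ.2 : False).elim
  | cneg _ => exact (hφ.1 : False).elim
  | and α β h1 h2 =>
    have hp := plain_and.1 hφ
    have ho : occ up α + occ up β = 0 := ho
    exact ⟨h1 hp.1 (by omega) hX h.1 fun s hs => (hf s hs).1,
      h2 hp.2 (by omega) hX h.2 fun s hs => (hf s hs).2⟩
  | or α β h1 h2 =>
    have hp := plain_or.1 hφ
    have ho : occ up α + occ up β = 0 := ho
    obtain ⟨Z, W, rfl, hZ, hW⟩ := h
    refine ⟨{s ∈ X' | FSat M I s α}, {s ∈ X' | FSat M I s β}, ?_,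
      h1 hp.1 (by omega) ?_ hZ fun s hs => hs.2, h2 hp.2 (by omega) ?_ hW fun s hs => hs.2⟩
    · ext s
      constructor
      · rintro (hs | hs)
        exacts [hs.1, hs.1]
      · exact fun hs => (hf s hs).imp (fun h => ⟨hs, h⟩) fun h => ⟨hs, h⟩
    · exact fun s hs => ⟨hX (.inl hs), fsat_of_tsat hp.1 hZ s hs⟩
    · exact fun s hs => ⟨hX (.inr hs), fsat_of_tsat hp.2 hW s hs⟩
  | ex v α h1 =>
    obtain ⟨H, hH, h⟩ := h
    refine ⟨fun s => {m | FSat M I (Function.update s v m) α}, hf,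
      h1 (plain_ex.1 hφ) ho ?_ h ?_⟩
    · rintro _ ⟨s, hs, m, hm, rfl⟩
      exact ⟨s, hX hs, m, fsat_of_tsat (plain_ex.1 hφ) h _ ⟨s, hs, m, hm, rfl⟩, rfl⟩
    · rintro _ ⟨s, -, m, hm, rfl⟩
      exact hm
  | al v α h1 =>
    refine h1 (plain_al.1 hφ) ho ?_ h ?_
    · rintro _ ⟨s, hs, m, rfl⟩
      exact ⟨s, hX hs, m, rfl⟩
    · rintro _ ⟨s, hs, m, rfl⟩
      exact hf s hs m

theorem foDef_tsat_of_occ_eq_zero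
    (hup : ∀ i, up i → ∀ M R R', R ⊆ R' → Y i M R → Y i M R')
    (hdef : ∀ i, up i → RDef (S := S) fun M _ R => Y i M R)
    {φ : TS S κ ar} (hφ : Plain φ) (ho : occ up φ = 0) (χ : FOF S) :
    FODef fun M I => TSat M I (fun i => Y i M) φ {s | FSat M I s χ} := by
  induction φ generalizing χ with
  | rel r v =>
    exact (FODef.forall_sat (.or (.cneg χ) (.rel r v))).congr fun M _ I =>
      forall_congr' fun s => imp_iff_not_or.symm
  | nrel r v =>
    exact (FODef.forall_sat (.or (.cneg χ) (.nrel r v))).congr fun M _ I =>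
      forall_congr' fun s => imp_iff_not_or.symm
  | eq x y =>
    exact (FODef.forall_sat (.or (.cneg χ) (.eq x y))).congr fun M _ I =>
      forall_congr' fun s => imp_iff_not_or.symm
  | neq x y =>
    exact (FODef.forall_sat (.or (.cneg χ) (.neq x y))).congr fun M _ I =>
      forall_congr' fun s => imp_iff_not_or.symm
  | dep i v =>
    have : up i := by
      by_contra hc
      simp [occ, hc] at ho
    exact (hdef i this).comp χ v
  | gdisj _ _ => exact (hφ.2 : False).elim
  | cneg _ => exact (hφ.1 : False).elim
  | and α β h1 h2 =>
    have hp := plain_and.1 hφ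
    have ho : occ up α + occ up β = 0 := ho
    exact (h1 hp.1 (by omega) χ).and (h2 hp.2 (by omega) χ)
  | or α β h1 h2 =>
    have hp := plain_or.1 hφ
    have ho' : occ up α + occ up β = 0 := ho
    refine (((h1 hp.1 (by omega) (.and χ (flat α))).and (h2 hp.2 (by omega) (.and χ (flat β)))).and
      (FODef.forall_sat (.or (.cneg χ) (.or (flat α) (flat β))))).congr fun M _ I => ?_
    simp only [FSat, fsat_flat]
    constructor
    · rintro ⟨⟨ha, hb⟩, hc⟩
      refine ⟨_, _, ?_, ha, hb⟩
      ext s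
      have := hc s
      simp only [Set.mem_union, Set.mem_ofPred_eq]
      tauto
    · intro h
      have hf := fsat_of_tsat hφ h
      obtain ⟨Z, W, e, hZ, hW⟩ := h
      refine ⟨⟨tsat_mono_of_occ_eq_zero hup hp.1 (by omega) ?_ hZ fun s hs => hs.2,
        tsat_mono_of_occ_eq_zero hup hp.2 (by omega) ?_ hW fun s hs => hs.2⟩,
        fun s => imp_iff_not_or.1 (hf s)⟩
      · exact fun s hs => ⟨e.subset (.inl hs), fsat_of_tsat hp.1 hZ s hs⟩
      · exact fun s hs => ⟨e.subset (.inr hs), fsat_of_tsat hp.2 hW s hs⟩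
  | ex v α h1 =>
    refine ((h1 (plain_ex.1 hφ) ho (.and (.ex v χ) (flat α))).and
      (FODef.forall_sat (.or (.cneg χ) (.ex v (flat α))))).congr fun M _ I => ?_
    simp only [FSat, fsat_flat]
    constructor
    · rintro ⟨h, hc⟩
      refine ⟨fun s => {m | FSat M I (Function.update s v m) α},
        fun s hs => (hc s).resolve_left (not_not.2 hs), ?_⟩
      convert h using 1
      ext s
      constructor
      · rintro ⟨s, hs, m, hm, rfl⟩
        exact ⟨⟨s v, by simpa using hs⟩, hm⟩
      · rintro ⟨⟨m, hm⟩, hs⟩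
        exact ⟨_, hm, s v, by simpa using hs, by simp⟩
    · intro h
      have hf := fsat_of_tsat hφ h
      obtain ⟨H, hH, h⟩ := h
      refine ⟨tsat_mono_of_occ_eq_zero hup (plain_ex.1 hφ) ho ?_ h fun s hs => hs.2,
        fun s => imp_iff_not_or.1 (hf s)⟩
      rintro _ ⟨s, hs, m, hm, rfl⟩
      exact ⟨⟨s v, by simpa using hs⟩,
        fsat_of_tsat (plain_ex.1 hφ) h _ ⟨s, hs, m, hm, rfl⟩⟩
  | al v α h1 =>
    refine (h1 (plain_al.1 hφ) ho (.ex v χ)).congr fun M _ I => ?_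
    have : {s : ℕ → M | FSat M I s (.ex v χ)} =
        {s' | ∃ s ∈ {s | FSat M I s χ}, ∃ m, s' = Function.update s v m} := by
      ext s
      constructor
      · rintro ⟨m, hm⟩
        exact ⟨_, hm, s v, by simp⟩
      · rintro ⟨s, hs, m, rfl⟩
        exact ⟨s v, by simpa using hs⟩
    rw [this]
    rfl

/-- An occurrence of a downwards closed dependency can be replaced by an existentially quantified
relation. -/
theorem exists_pull (hdown : ∀ i, ¬ up i → ∀ M R R', R ⊆ R' → Y i M R' → Y i M R)
    {φ : TS S κ ar} (hφ : Plain φ) (ho : 0 < occ up φ) :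
    ∃ i, ¬ up i ∧ ∃ φ' : TS (SigAdd S (ar i)) κ ar, Plain φ' ∧ occ up φ' + 1 = occ up φ ∧
      ∀ (M : Type) (I : Interp S M) (X : Set (ℕ → M)),
        (TSat M I (fun i => Y i M) φ X ↔
          ∃ R, Y i M R ∧ TSat M (addI I R) (fun i => Y i M) φ' X) ∧
        ∀ R R', R ⊆ R' → TSat M (addI I R) (fun i => Y i M) φ' X →
          TSat M (addI I R') (fun i => Y i M) φ' X := by
  have hmap : ∀ {k : ℕ} {M : Type} {I : Interp S M} {R : Set (Fin k → M)} (β : TS S κ ar)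
      (X : Set (ℕ → M)), TSat M (addI I R) (fun i => Y i M)
        (mapSig (S' := SigAdd S k) (fun _ => Sum.inl) β) X ↔ TSat M I (fun i => Y i M) β X :=
    fun β X => tsat_mapSig _ β X
  have hocc : ∀ {k : ℕ} (β : TS S κ ar),
      occ up (mapSig (S' := SigAdd S k) (fun _ => Sum.inl) β) = occ up β :=
    fun β => occ_mapSig _ β
  induction φ with
  | rel r v => exact absurd ho (lt_irrefl 0)
  | nrel r v => exact absurd ho (lt_irrefl 0)
  | eq x y => exact absurd ho (lt_irrefl 0)
  | neq x y => exact absurd ho (lt_irrefl 0)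
  | gdisj _ _ => exact (hφ.2 : False).elim
  | cneg _ => exact (hφ.1 : False).elim
  | dep i v =>
    have hi : ¬ up i := by
      intro hc
      simp [occ, hc] at ho
    refine ⟨i, hi, .rel (newSym S (ar i)) v, ⟨trivial, trivial⟩, by simp [occ, hi],
      fun M I X => ⟨⟨fun h => ⟨_, h, fun s hs => ⟨s, hs, rfl⟩⟩, ?_⟩,
        fun R R' hR h s hs => hR (h s hs)⟩⟩
    rintro ⟨R, hR, h⟩
    refine hdown i hi M _ R ?_ hR
    rintro _ ⟨s, hs, rfl⟩
    exact h s hs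
  | and α β h1 h2 =>
    have hp := plain_and.1 hφ
    have ho' : 0 < occ up α + occ up β := ho
    by_cases hα : 0 < occ up α
    · obtain ⟨i, hi, φ', hp', he, h⟩ := h1 hp.1 hα
      refine ⟨i, hi, .and φ' (mapSig (fun _ => Sum.inl) β),
        plain_and.2 ⟨hp', (plain_mapSig _ _).2 hp.2⟩, ?_, fun M I X => ⟨?_, ?_⟩⟩
      · simp only [occ, hocc]; omega
      · simp only [TSat, hmap, (h M I X).1]
        exact ⟨fun ⟨⟨R, a, b⟩, c⟩ => ⟨R, a, b, c⟩, fun ⟨R, a, b, c⟩ => ⟨⟨R, a, b⟩, c⟩⟩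
      · simp only [TSat, hmap]
        exact fun R R' hR hh => ⟨(h M I X).2 R R' hR hh.1, hh.2⟩
    · obtain ⟨i, hi, φ', hp', he, h⟩ := h2 hp.2 (by omega)
      refine ⟨i, hi, .and (mapSig (fun _ => Sum.inl) α) φ',
        plain_and.2 ⟨(plain_mapSig _ _).2 hp.1, hp'⟩, ?_, fun M I X => ⟨?_, ?_⟩⟩
      · simp only [occ, hocc]; omega
      · simp only [TSat, hmap, (h M I X).1]
        exact ⟨fun ⟨c, R, a, b⟩ => ⟨R, a, c, b⟩, fun ⟨R, a, c, b⟩ => ⟨c, R, a, b⟩⟩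
      · simp only [TSat, hmap]
        exact fun R R' hR hh => ⟨hh.1, (h M I X).2 R R' hR hh.2⟩
  | or α β h1 h2 =>
    have hp := plain_or.1 hφ
    have ho' : 0 < occ up α + occ up β := ho
    by_cases hα : 0 < occ up α
    · obtain ⟨i, hi, φ', hp', he, h⟩ := h1 hp.1 hα
      refine ⟨i, hi, .or φ' (mapSig (fun _ => Sum.inl) β),
        plain_or.2 ⟨hp', (plain_mapSig _ _).2 hp.2⟩, ?_, fun M I X => ⟨?_, ?_⟩⟩
      · simp only [occ, hocc]; omega
      · simp only [TSat, hmap, fun X => (h M I X).1]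
        exact ⟨fun ⟨Z, W, e, ⟨R, a, b⟩, c⟩ => ⟨R, a, Z, W, e, b, c⟩,
          fun ⟨R, a, Z, W, e, b, c⟩ => ⟨Z, W, e, ⟨R, a, b⟩, c⟩⟩
      · simp only [TSat, hmap]
        exact fun R R' hR ⟨Z, W, e, b, c⟩ => ⟨Z, W, e, (h M I Z).2 R R' hR b, c⟩
    · obtain ⟨i, hi, φ', hp', he, h⟩ := h2 hp.2 (by omega)
      refine ⟨i, hi, .or (mapSig (fun _ => Sum.inl) α) φ',
        plain_or.2 ⟨(plain_mapSig _ _).2 hp.1, hp'⟩, ?_, fun M I X => ⟨?_, ?_⟩⟩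
      · simp only [occ, hocc]; omega
      · simp only [TSat, hmap, fun X => (h M I X).1]
        exact ⟨fun ⟨Z, W, e, c, R, a, b⟩ => ⟨R, a, Z, W, e, c, b⟩,
          fun ⟨R, a, Z, W, e, c, b⟩ => ⟨Z, W, e, c, R, a, b⟩⟩
      · simp only [TSat, hmap]
        exact fun R R' hR ⟨Z, W, e, c, b⟩ => ⟨Z, W, e, c, (h M I W).2 R R' hR b⟩
  | ex v α h1 =>
    obtain ⟨i, hi, φ', hp', he, h⟩ := h1 (plain_ex.1 hφ) ho
    refine ⟨i, hi, .ex v φ', plain_ex.2 hp', he, fun M I X => ⟨?_, ?_⟩⟩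
    · simp only [TSat, fun X => (h M I X).1]
      exact ⟨fun ⟨H, e, R, a, b⟩ => ⟨R, a, H, e, b⟩, fun ⟨R, a, H, e, b⟩ => ⟨H, e, R, a, b⟩⟩
    · exact fun R R' hR ⟨H, e, b⟩ => ⟨H, e, (h M I _).2 R R' hR b⟩
  | al v α h1 =>
    obtain ⟨i, hi, φ', hp', he, h⟩ := h1 (plain_al.1 hφ) ho
    exact ⟨i, hi, .al v φ', plain_al.2 hp', he, fun M I X => h M I _⟩

/-- A family of definable upwards closed dependencies and downwards closed dependencies along which
definable monotone classes can be projected is strongly first order. -/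
theorem sfoFam_of_monotone
    (hup : ∀ i, up i → ∀ M R R', R ⊆ R' → Y i M R → Y i M R')
    (hdef : ∀ (S : Signature) i, up i → RDef (S := S) fun M _ R => Y i M R)
    (hdown : ∀ i, ¬ up i → ∀ M R R', R ⊆ R' → Y i M R' → Y i M R)
    (hproj : ∀ (S : Signature) i, ¬ up i →
      ∀ K : ∀ M : Type, Interp S M → Set (Fin (ar i) → M) → Prop, RDef K → MonoR K →
        FODef fun M I => ∃ R, Y i M R ∧ K M I R) : SFOFam Y := by
  rw [sfoFam_iff]
  intro S φ hφ
  induction hm : occ up φ generalizing S with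
  | zero =>
    refine (foDef_tsat_of_occ_eq_zero hup (hdef S) hφ hm (.eq 0 0)).congr fun M _ I => ?_
    simp [FSat, TTrue]
  | succ m ih =>
    obtain ⟨i, hi, φ', hp', he, h⟩ := exists_pull hdown hφ (by omega)
    obtain ⟨ψ, hψ⟩ := ih _ φ' hp' (by omega)
    refine (hproj S i hi (fun M I R => TTrue M (addI I R) (fun i => Y i M) φ')
      ⟨ψ, fun M hM I R s => hψ M hM _ s⟩
      fun M _ I R R' hR => (h M I Set.univ).2 R R' hR).congr fun M _ I => ?_
    exact (h M I Set.univ).1.symm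

theorem exists_plain_list {φ : TS S κ ar} (hφ : NoCneg φ) :
    ∃ L : List (TS S κ ar), (∀ ψ ∈ L, Plain ψ) ∧
      ∀ (M : Type) (I : Interp S M) (A : ∀ i, Set (Fin (ar i) → M) → Prop) (X : Set (ℕ → M)),
        TSat M I A φ X ↔ ∃ ψ ∈ L, TSat M I A ψ X := by
  induction φ with
  | rel r v => exact ⟨[.rel r v], by simp [Plain, NoCneg, NoGdisj], by simp⟩
  | nrel r v => exact ⟨[.nrel r v], by simp [Plain, NoCneg, NoGdisj], by simp⟩
  | eq x y => exact ⟨[.eq x y], by simp [Plain, NoCneg, NoGdisj], by simp⟩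
  | neq x y => exact ⟨[.neq x y], by simp [Plain, NoCneg, NoGdisj], by simp⟩
  | dep i v => exact ⟨[.dep i v], by simp [Plain, NoCneg, NoGdisj], by simp⟩
  | cneg _ => exact (hφ : False).elim
  | and α β h1 h2 =>
    obtain ⟨L1, p1, h1⟩ := h1 hφ.1
    obtain ⟨L2, p2, h2⟩ := h2 hφ.2
    refine ⟨L1.flatMap fun a => L2.map fun b => .and a b, ?_, fun M I A X => ?_⟩
    · simp only [List.mem_flatMap, List.mem_map]
      rintro _ ⟨a, ha, b, hb, rfl⟩
      exact plain_and.2 ⟨p1 _ ha, p2 _ hb⟩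
    · simp only [List.mem_flatMap, List.mem_map, TSat, h1, h2]
      constructor
      · rintro ⟨⟨a, ha, h⟩, b, hb, h'⟩
        exact ⟨_, ⟨a, ha, b, hb, rfl⟩, h, h'⟩
      · rintro ⟨_, ⟨a, ha, b, hb, rfl⟩, h, h'⟩
        exact ⟨⟨a, ha, h⟩, b, hb, h'⟩
  | or α β h1 h2 =>
    obtain ⟨L1, p1, h1⟩ := h1 hφ.1
    obtain ⟨L2, p2, h2⟩ := h2 hφ.2
    refine ⟨L1.flatMap fun a => L2.map fun b => .or a b, ?_, fun M I A X => ?_⟩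
    · simp only [List.mem_flatMap, List.mem_map]
      rintro _ ⟨a, ha, b, hb, rfl⟩
      exact plain_or.2 ⟨p1 _ ha, p2 _ hb⟩
    · simp only [List.mem_flatMap, List.mem_map, TSat, h1, h2]
      constructor
      · rintro ⟨Z, W, e, ⟨a, ha, h⟩, b, hb, h'⟩
        exact ⟨_, ⟨a, ha, b, hb, rfl⟩, Z, W, e, h, h'⟩
      · rintro ⟨_, ⟨a, ha, b, hb, rfl⟩, Z, W, e, h, h'⟩
        exact ⟨Z, W, e, ⟨a, ha, h⟩, b, hb, h'⟩
  | gdisj α β h1 h2 =>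
    obtain ⟨L1, p1, h1⟩ := h1 hφ.1
    obtain ⟨L2, p2, h2⟩ := h2 hφ.2
    refine ⟨L1 ++ L2, fun ψ hψ => (List.mem_append.1 hψ).elim (p1 ψ) (p2 ψ), fun M I A X => ?_⟩
    simp only [TSat, h1, h2, List.mem_append, or_and_right, exists_or]
  | ex v α h1 =>
    obtain ⟨L, p, h⟩ := h1 hφ
    refine ⟨L.map (.ex v), ?_, fun M I A X => ?_⟩
    · simp only [List.mem_map]
      rintro _ ⟨ψ, hψ, rfl⟩
      exact plain_ex.2 (p ψ hψ)
    · simp only [List.mem_map, TSat, h]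
      constructor
      · rintro ⟨H, e, ψ, hψ, h⟩
        exact ⟨_, ⟨ψ, hψ, rfl⟩, H, e, h⟩
      · rintro ⟨_, ⟨ψ, hψ, rfl⟩, H, e, h⟩
        exact ⟨H, e, ψ, hψ, h⟩
  | al v α h1 =>
    obtain ⟨L, p, h⟩ := h1 hφ
    refine ⟨L.map (.al v), ?_, fun M I A X => ?_⟩
    · simp only [List.mem_map]
      rintro _ ⟨ψ, hψ, rfl⟩
      exact plain_al.2 (p ψ hψ)
    · simp only [List.mem_map, TSat, h]
      constructor
      · rintro ⟨ψ, hψ, h⟩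
        exact ⟨_, ⟨ψ, hψ, rfl⟩, h⟩
      · rintro ⟨_, ⟨ψ, hψ, rfl⟩, h⟩
        exact ⟨ψ, hψ, h⟩

end Elimination

section Main

variable {ι : Type} {ar : ι → ℕ}

/-- The levels of the difference hierarchies of a family, and their complements. -/
def levelFam (D : ∀ i, DepPred (ar i)) : ∀ x : (ι × ℕ) × Bool, DepPred (ar x.1.1) :=
  fun x M R => match x.2 with
    | true => diffH (D x.1.1) x.1.2 M R
    | false => ¬ diffH (D x.1.1) x.1.2 M R

theorem sfoFam_levelFam {D : ∀ i, DepPred (ar i)} (h : ∀ i, DSFOd (D i)) :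
    SFOFam (levelFam D) := by
  refine sfoFam_of_monotone (up := fun x => x.2 = false) ?_ ?_ ?_ ?_
  · rintro ⟨⟨i, j⟩, _⟩ rfl M R R' hR hn
    exact fun h' => hn (diffH_anti hR h')
  · rintro S ⟨⟨i, j⟩, _⟩ rfl
    obtain ⟨ψ, hψ⟩ := (good_diffH (h i) j).rDef (h i) S
    exact ⟨.cneg ψ, fun M hM I R s => not_congr (hψ M hM I R s)⟩
  · rintro ⟨⟨i, j⟩, _ | _⟩ hb M R R' hR h'
    · exact absurd rfl hb
    · exact diffH_anti hR h'
  · rintro S ⟨⟨i, j⟩, _ | _⟩ hb K hd hK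
    · exact absurd rfl hb
    · exact (good_diffH (h i) j).exists_foDef (h i) hd hK

/-- The expression of `D i` (`b = true`) or `∼(D i)` (`b = false`) by means of the first `N`
levels of its difference hierarchy. -/
def levelF {S : Signature} (N : ℕ) (b : Bool) (i : ι) (v : Fin (ar i) → ℕ) :
    TS S ((ι × ℕ) × Bool) fun x => ar x.1.1 :=
  ((List.range N).filter fun j => parity j = !b).foldr
    (fun j φ => .gdisj (.and (.dep ((i, j), true) v) (.dep ((i, j + 1), false) v)) φ)
    (.dep ((i, N), true) v)

theorem noCneg_levelF {S : Signature} (N : ℕ) (b : Bool) (i : ι) (v : Fin (ar i) → ℕ) :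
    NoCneg (levelF N b i v : TS S _ _) := by
  unfold levelF
  induction (List.range N).filter _ with
  | nil => trivial
  | cons j l ih => exact ⟨⟨trivial, trivial⟩, ih⟩

theorem tsat_levelF {S : Signature} {D : ∀ i, DepPred (ar i)} {M : Type} {I : Interp S M} {N : ℕ}
    {i : ι} (hN : ∀ R, ¬ diffH (D i) N M R) (b : Bool) (v : Fin (ar i) → ℕ) (X : Set (ℕ → M)) :
    TSat M I (fun x => levelFam D x M) (levelF N b i v) X ↔ pairFam (D i) b M (teamProj v X) := by
  have : ∀ l : List ℕ, TSat M I (fun x => levelFam D x M) (l.foldr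
      (fun j φ => .gdisj (.and (.dep ((i, j), true) v) (.dep ((i, j + 1), false) v)) φ)
      (.dep ((i, N), true) v)) X ↔
      ∃ j ∈ l, diffH (D i) j M (teamProj v X) ∧ ¬ diffH (D i) (j + 1) M (teamProj v X) := by
    intro l
    induction l with
    | nil => exact ⟨fun h => (hN _ h).elim, by simp⟩
    | cons j l ih =>
      rw [List.foldr_cons, List.exists_mem_cons_iff, ← ih]
      rfl
  rw [levelF, this, pairFam_iff_diffH hN]
  simp [and_assoc]

theorem sfoFam_withComplFam {D : ∀ i, DepPred (ar i)} (h : ∀ i, DSFOd (D i)) :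
    SFOFam (withComplFam D) := by
  rw [sfoFam_iff]
  intro S φ hφ
  choose N hN using fun i => exists_diffH_empty (h i)
  let σ : ∀ x : ι ⊕ ι, (Fin (Sum.elim ar ar x) → ℕ) →
      TS S ((ι × ℕ) × Bool) fun x => ar x.1.1 := fun x => match x with
    | .inl i => levelF (N i) true i
    | .inr i => levelF (N i) false i
  have hσ : ∀ x v, NoCneg (σ x v) := by
    rintro (i | i) v
    exacts [noCneg_levelF .., noCneg_levelF ..]
  obtain ⟨L, hL, hs⟩ := exists_plain_list (noCneg_bindDep hσ hφ.1)
  refine (FODef.exists_mem L fun ψ hψ =>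
    sfoFam_iff.1 (sfoFam_levelFam h) S ψ (hL ψ hψ)).congr fun M hM I => ?_
  refine (hs M I _ Set.univ).symm.trans (tsat_bindDep σ ?_ φ Set.univ)
  rintro (i | i) v X
  · exact tsat_levelF (hN i M hM) true v X
  · exact tsat_levelF (hN i M hM) false v X

theorem dsfod_of_sfoFam_withComplFam {D : ∀ i, DepPred (ar i)} (h : SFOFam (withComplFam D))
    (i : ι) : DSFOd (D i) := by
  refine sfoFam_iff.2 fun S φ hφ => ?_
  let σ : Bool → (Fin (ar i) → ℕ) → TS S (ι ⊕ ι) (Sum.elim ar ar) := fun b v => match b with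
    | true => .dep (.inl i) v
    | false => .dep (.inr i) v
  have hσ : ∀ b v, Plain (σ b v) := by
    rintro (_ | _) v
    exacts [⟨trivial, trivial⟩, ⟨trivial, trivial⟩]
  refine (sfoFam_iff.1 h S _ (plain_bindDep hσ hφ)).congr fun M hM I => ?_
  refine tsat_bindDep σ ?_ φ Set.univ
  rintro (_ | _) v X
  exacts [Iff.rfl, Iff.rfl]

end Main

/-- A family of relativizable generalized dependencies is doubly
strongly first order iff every dependency in it is doubly strongly first
order. -/
theorem family_doubly_sfo_iff_each {ι : Type} {ar : ι → ℕ}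
    (D : ∀ i, DepPred (ar i)) (hiso : ∀ i, IsoClosed (D i))
    (hrel : ∀ i, Relativizable1 (D i)) :
    SFOFam (withComplFam D) ↔ ∀ i, DSFOd (D i) := by
  exact ⟨fun h i => dsfod_of_sfoFam_withComplFam h i, sfoFam_withComplFam⟩

end DSFO
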